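/- arXiv:2106.04347 — 3 statements merged into one kernel-verified Lean document; each statement's English description precedes it below -/
import Mathlib

section
/- For any multiset M = {1^{k_1}, 2^{k_2}, …, n^{k_n}} with each k_i ≥ 1, the coefficient sequence of the quasi-Stirling polynomial Q̄_M(t) is log-concave: writing q_j for the number of quasi-Stirling permutations π of M with des(π) = j, one has q_j² ≥ q_{j−1}·q_{j+1} for all j ≥ 1. -/
open scoped Classical

/-- The number of descents of a word plus one, as in the paper:
`des π = |{i : π_i > π_{i+1}}| + 1`. -/
def des (w : List ℕ) : ℕ :=
  ((List.range (w.length - 1)).filter fun i => w.getD (i + 1) 0 < w.getD i 0).length + 1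

/-- A word is quasi-Stirling if there are no indices `i < j < k < l` with
`π_i = π_k` and `π_j = π_l`. -/
def QuasiStirling (w : List ℕ) : Prop :=
  ¬ ∃ i j k l : ℕ, i < j ∧ j < k ∧ k < l ∧ l < w.length ∧
      w.getD i 0 = w.getD k 0 ∧ w.getD j 0 = w.getD l 0

/-- A word is a Stirling permutation if whenever `i < j < k` and `π_i = π_k`,
then `π_j > π_i`. -/
def StirlingPerm (w : List ℕ) : Prop :=
  ∀ i j k : ℕ, i < j → j < k → k < w.length →
    w.getD i 0 = w.getD k 0 → w.getD i 0 < w.getD j 0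

/-- The finset of quasi-Stirling permutations of the multiset `M`
(words `w` with `↑w = M` that are quasi-Stirling). -/
noncomputable def qsPerms (M : Multiset ℕ) : Finset (List ℕ) :=
  M.toList.permutations.toFinset.filter QuasiStirling

/-- The finset of Stirling permutations of the multiset `M`. -/
noncomputable def sPerms (M : Multiset ℕ) : Finset (List ℕ) :=
  M.toList.permutations.toFinset.filter StirlingPerm

/-- The quasi-Stirling polynomial `Q̄_M(t) = Σ_{π quasi-Stirling} t^{des π}`. -/
noncomputable def qsPoly (M : Multiset ℕ) : Polynomial ℚ :=
  ∑ w ∈ qsPerms M, Polynomial.X ^ des w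

/-- The Stirling polynomial `Q_M(t) = Σ_{π Stirling} t^{des π}`. -/
noncomputable def sPoly (M : Multiset ℕ) : Polynomial ℚ :=
  ∑ w ∈ sPerms M, Polynomial.X ^ des w

/-- `qCount M j` is the number of quasi-Stirling permutations of `M` with `des = j`. -/
noncomputable def qCount (M : Multiset ℕ) (j : ℕ) : ℕ :=
  ((qsPerms M).filter fun w => des w = j).card

namespace QuasiStirlingWords

open List

/-- A word is noncrossing if no two distinct letters occur in the pattern `x y x y`. -/
def Noncrossing (w : List ℕ) : Prop :=
  ∀ x y, [x, y, x, y] <+ w → x = y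

/-- The number of strict descents between consecutive letters of a word. -/
def linDes : List ℕ → ℕ
  | [] => 0
  | [_] => 0
  | a :: b :: l => (if b < a then 1 else 0) + linDes (b :: l)

/-- The number of strict descents of a word read cyclically. -/
def cycDes (w : List ℕ) : ℕ := linDes (w ++ w.take 1)

theorem linDes_split (u : List ℕ) (x : ℕ) (v : List ℕ) :
    linDes (u ++ x :: v) = linDes (u ++ [x]) + linDes (x :: v) := by
  induction u with
  | nil => simp [linDes]
  | cons a u ih =>
    cases u with
    | nil => simp [linDes]
    | cons b u =>
      simp only [cons_append, linDes] at ih ⊢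
      omega

theorem linDes_le (w : List ℕ) : linDes w ≤ w.length - 1 := by
  induction w with
  | nil => simp [linDes]
  | cons a u ih =>
    cases u with
    | nil => simp [linDes]
    | cons b u =>
      simp only [linDes, length_cons] at ih ⊢
      split_ifs <;> omega

theorem linDes_eq_card (w : List ℕ) :
    linDes w = ((Finset.range (w.length - 1)).filter
      fun i => w.getD (i + 1) 0 < w.getD i 0).card := by
  induction w with
  | nil => simp [linDes]
  | cons a u ih =>
    cases u with
    | nil => simp [linDes]
    | cons b u =>
      rw [linDes, ih]
      simp only [length_cons, Nat.add_sub_cancel, Finset.card_filter]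
      rw [Finset.sum_range_succ', add_comm]
      simp only [getD_cons_succ, getD_cons_zero, zero_add]

theorem des_eq_linDes (w : List ℕ) : des w = linDes w + 1 := by
  rw [linDes_eq_card, des, Finset.card_filter, ← List.countP_eq_length_filter]
  congr 1
  generalize w.length - 1 = m
  induction m with
  | zero => simp
  | succ m ih => rw [List.range_succ, List.countP_append, ih, Finset.sum_range_succ]; simp

theorem cycDes_le_length (w : List ℕ) : cycDes w ≤ w.length := by
  refine (linDes_le _).trans ?_
  simp only [length_append, length_take]
  omega

theorem cycDes_append_comm (u v : List ℕ) : cycDes (u ++ v) = cycDes (v ++ u) := by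
  cases u with
  | nil => simp
  | cons x u =>
    cases v with
    | nil => simp
    | cons y v =>
      have h1 := linDes_split (x :: u) y (v ++ [x])
      have h2 := linDes_split (y :: v) x (u ++ [y])
      simp only [cycDes, cons_append, take_succ_cons, take_zero, append_assoc] at *
      omega

theorem cycDes_rotate (w : List ℕ) (n : ℕ) : cycDes (w.rotate n) = cycDes w := by
  rw [rotate_eq_drop_append_take_mod, cycDes_append_comm, take_append_drop]

theorem linDes_cons_of_max {a : ℕ} {u : List ℕ} (hu : u ≠ []) (h : ∀ x ∈ u, x < a) :
    linDes (a :: u) = linDes u + 1 := by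
  cases u with
  | nil => exact absurd rfl hu
  | cons b u => simp [linDes, h b (by simp), add_comm]

theorem linDes_cons_zero (u : List ℕ) : linDes (0 :: u) = linDes u := by
  cases u <;> simp [linDes]

theorem linDes_concat (u : List ℕ) (hu : u ≠ []) (y : ℕ) :
    linDes (u ++ [y]) = linDes u + if y < u.getLastD 0 then 1 else 0 := by
  induction u with
  | nil => exact absurd rfl hu
  | cons a u ih =>
    cases u with
    | nil => simp [linDes]
    | cons b u =>
      have := ih (by simp)
      simp only [cons_append, linDes, getLastD_cons] at this ⊢
      omega

theorem getLastD_mem {u : List ℕ} (hu : u ≠ []) : u.getLastD 0 ∈ u := by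
  rw [getLastD_eq_getLast?, getLast?_eq_getLast_of_ne_nil hu]
  exact getLast_mem hu

theorem linDes_surround {a : ℕ} {p : List ℕ} (ha : ∀ x ∈ p, x < a) (h0 : ∀ x ∈ p, 0 < x) :
    linDes (a :: (p ++ [a])) = linDes (0 :: (p ++ [0])) := by
  rcases eq_or_ne p [] with rfl | hp
  · simp [linDes]
  · have e := linDes_split [a] (p.head hp) (p.tail ++ [a])
    rw [← cons_append, cons_head_tail] at e
    have hl := getLastD_mem hp
    rw [linDes_cons_zero, linDes_concat p hp, ← cons_append, linDes_concat _ (by simp),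
      linDes_cons_of_max hp ha, getLastD_cons]
    have h1 := ha _ hl
    have h2 := h0 _ hl
    have : p.getLastD a = p.getLastD 0 := by cases p with
      | nil => exact absurd rfl hp
      | cons b p => rw [getLastD_cons, getLastD_cons]
    rw [this, if_pos h2, if_neg h1.not_gt]

theorem Noncrossing.sublist {u v : List ℕ} (hv : Noncrossing v) (h : u <+ v) : Noncrossing u :=
  fun x y hxy => hv x y (hxy.trans h)

theorem Noncrossing.append_comm {u v : List ℕ} (h : Noncrossing (u ++ v)) :
    Noncrossing (v ++ u) := by
  intro x y hxy
  obtain ⟨l₁, l₂, he, h₁, h₂⟩ := sublist_append_iff.1 hxy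
  have h3 := h₂.append h₁
  have hx := h x y
  have hy := h y x
  rcases l₁ with _ | ⟨a, _ | ⟨b, _ | ⟨c, _ | ⟨d, l₁⟩⟩⟩⟩ <;>
    simp only [nil_append, cons_append, cons.injEq] at he <;> grind

theorem Noncrossing.rotate {w : List ℕ} (h : Noncrossing w) (n : ℕ) :
    Noncrossing (w.rotate n) := by
  rw [rotate_eq_drop_append_take_mod]
  apply Noncrossing.append_comm
  rwa [take_append_drop]

theorem noncrossing_insert_disjoint {p u q : List ℕ} (hp : ∀ x ∈ u, x ∉ p) (hq : ∀ x ∈ u, x ∉ q) :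
    Noncrossing (p ++ (u ++ q)) ↔ Noncrossing u ∧ Noncrossing (p ++ q) := by
  constructor
  · intro h
    refine ⟨h.sublist ?_, h.sublist ?_⟩
    · exact (sublist_append_left u q).trans (sublist_append_right p _)
    · exact (Sublist.refl p).append (sublist_append_right u q)
  · rintro ⟨hu, hpq⟩ x y hxy
    obtain ⟨l₁, l, he, h₁, h⟩ := sublist_append_iff.1 hxy
    obtain ⟨l₂, l₃, rfl, h₂, h₃⟩ := sublist_append_iff.1 h
    have hd1 : ∀ z ∈ l₂, z ∉ l₁ := fun z hz hz' => hp z (h₂.subset hz) (h₁.subset hz')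
    have hd3 : ∀ z ∈ l₂, z ∉ l₃ := fun z hz hz' => hq z (h₂.subset hz) (h₃.subset hz')
    have e1 : l₂ = [x, y, x, y] → x = y := fun e => hu x y (e ▸ h₂)
    have e2 : l₁ ++ l₃ = [x, y, x, y] → x = y := fun e => hpq x y (e ▸ h₁.append h₃)
    clear hp hq hu hpq hxy h₁ h₂ h₃ h
    rcases l₁ with _ | ⟨a, _ | ⟨b, _ | ⟨c, _ | ⟨d, l₁⟩⟩⟩⟩ <;>
    rcases l₂ with _ | ⟨a', _ | ⟨b', _ | ⟨c', _ | ⟨d', l₂⟩⟩⟩⟩ <;>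
      simp only [nil_append, cons_append, cons.injEq, mem_cons, forall_eq_or_imp, not_mem_nil,
        not_false_eq_true, implies_true, and_true, IsEmpty.forall_iff, nil_eq,
        append_eq_nil_iff] at he hd1 hd3 <;> grind

theorem noncrossing_dup {p q : List ℕ} {a : ℕ} :
    Noncrossing (p ++ a :: a :: q) ↔ Noncrossing (p ++ a :: q) := by
  constructor
  · intro h
    exact h.sublist ((Sublist.refl p).append (sublist_cons_self a _))
  · intro h x y hxy
    by_contra hne
    obtain ⟨l₁, l, he, h₁, h₂⟩ := sublist_append_iff.1 hxy
    have key : l <+ a :: q := by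
      rcases sublist_cons_iff.1 h₂ with h3 | ⟨l', rfl, h3⟩
      · exact h3
      · rcases sublist_cons_iff.1 h3 with h4 | ⟨l'', rfl, h4⟩
        · exact h4.cons_cons a
        · exfalso
          rcases l₁ with _ | ⟨a, _ | ⟨b, _ | ⟨c, _ | ⟨d, l₁⟩⟩⟩⟩ <;>
            simp only [nil_append, cons_append, cons.injEq] at he <;> grind
    exact hne (h x y (he ▸ h₁.append key))

theorem exists_rotate_eq (w : List ℕ) (i : ℕ) : ∃ m, (w.rotate m).rotate i = w := by
  refine ⟨w.length * i - i, ?_⟩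
  rcases Nat.eq_zero_or_pos w.length with h | h
  · simp [length_eq_zero_iff.1 h]
  · rw [rotate_rotate, Nat.sub_add_cancel (Nat.le_mul_of_pos_left i h), rotate_length_mul]

/-- Double counting of words in a rotation-closed set together with a distinguished rotation. -/
theorem length_mul_card_filter {S : Finset (List ℕ)} {L : ℕ}
    (hrot : ∀ w ∈ S, ∀ i, w.rotate i ∈ S) (P : List ℕ → Prop) :
    L * (S.filter P).card =
      ∑ w ∈ S, ((Finset.range L).filter fun i => P (w.rotate i)).card := by
  have h : ∀ i, (S.filter fun w => P (w.rotate i)).card = (S.filter P).card := by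
    intro i
    refine Finset.card_bij (fun w _ => w.rotate i) ?_ ?_ ?_
    · intro w hw
      simp only [Finset.mem_filter] at hw ⊢
      exact ⟨hrot w hw.1 i, hw.2⟩
    · intro u _ v _ huv
      exact rotate_injective i huv
    · intro w hw
      simp only [Finset.mem_filter] at hw
      obtain ⟨m, hm⟩ := exists_rotate_eq w i
      refine ⟨w.rotate m, ?_, hm⟩
      simp only [Finset.mem_filter, hm]
      exact ⟨hrot w hw.1 m, hw.2⟩
  simp only [Finset.card_filter] at h ⊢
  rw [Finset.sum_comm, Finset.sum_congr rfl fun i _ => h i]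
  simp

theorem length_mul_card_filter_of_unique {S : Finset (List ℕ)} {L : ℕ}
    (hrot : ∀ w ∈ S, ∀ i, w.rotate i ∈ S) (P : List ℕ → Prop)
    (h : ∀ w ∈ S, ∃! i, i < L ∧ P (w.rotate i)) :
    L * (S.filter P).card = S.card := by
  rw [length_mul_card_filter hrot, Finset.card_eq_sum_ones]
  refine Finset.sum_congr rfl fun w hw => ?_
  obtain ⟨i, hi, hu⟩ := h w hw
  rw [Finset.card_eq_one]
  refine ⟨i, Finset.ext fun m => ?_⟩
  simp only [Finset.mem_filter, Finset.mem_range, Finset.mem_singleton]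
  exact ⟨hu m, fun e => e ▸ hi⟩

/-- The last letter of the word exceeds its first letter. -/
def DescentAtSeam (w : List ℕ) : Prop := w.getD 0 0 < w.getLastD 0

theorem descentAtSeam_rotate_iff {w : List ℕ} {i : ℕ} (hi : i < w.length) :
    DescentAtSeam (w.rotate (i + 1)) ↔
      (w ++ w.take 1).getD (i + 1) 0 < (w ++ w.take 1).getD i 0 := by
  have hrot : w.rotate (i + 1) = w.drop (i + 1) ++ w.take i ++ [w[i]] := by
    rw [rotate_eq_drop_append_take hi, append_assoc, take_concat_get']
  have e1 : (w ++ w.take 1).getD i 0 = w[i] := by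
    rw [getD_append _ _ _ _ hi, getD_eq_getElem _ _ hi]
  have e2 : (w.rotate (i + 1)).getLastD 0 = w[i] := by
    rw [hrot, getLastD_concat]
  have e3 : (w.rotate (i + 1)).getD 0 0 = (w ++ w.take 1).getD (i + 1) 0 := by
    rw [rotate_eq_drop_append_take hi]
    rcases Nat.lt_or_ge (i + 1) w.length with h | h
    · rw [getD_append _ _ _ _ h, getD_append _ _ _ _ (by simp; omega)]
      simp
    · rw [drop_eq_nil_of_le h, getD_append_right _ _ _ _ h]
      have : i + 1 = w.length := by omega
      cases w with
      | nil => simp at hi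
      | cons a w => simp [this]
  rw [DescentAtSeam, e1, e2, e3]

theorem card_descentAtSeam (w : List ℕ) :
    ((Finset.range w.length).filter fun i => DescentAtSeam (w.rotate i)).card = cycDes w := by
  rcases eq_or_ne w [] with rfl | hw
  · simp [cycDes, linDes]
  have hlen : 0 < w.length := length_pos_iff.2 hw
  have hshift : ((Finset.range w.length).filter fun i => DescentAtSeam (w.rotate i)).card =
      ((Finset.range w.length).filter fun i => DescentAtSeam (w.rotate (i + 1))).card := by
    obtain ⟨m, hm⟩ : ∃ m, w.length = m + 1 := ⟨w.length - 1, by omega⟩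
    simp only [Finset.card_filter]
    rw [hm, Finset.sum_range_succ', Finset.sum_range_succ, ← hm, rotate_length, rotate_zero]
  rw [hshift, cycDes, linDes_eq_card]
  have : (w ++ w.take 1).length - 1 = w.length := by
    simp only [length_append, length_take]; omega
  rw [this]
  congr 1
  refine Finset.filter_congr fun i hi => ?_
  exact descentAtSeam_rotate_iff (Finset.mem_range.1 hi)

/-- The noncrossing words with letter multiset `M` having `j` cyclic descents. -/
noncomputable def words (M : Multiset ℕ) (j : ℕ) : Finset (List ℕ) :=
  M.lists.toFinset.filter fun w => Noncrossing w ∧ cycDes w = j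

theorem mem_words {M : Multiset ℕ} {j : ℕ} {w : List ℕ} :
    w ∈ words M j ↔ (w : Multiset ℕ) = M ∧ Noncrossing w ∧ cycDes w = j := by
  rw [words, Finset.mem_filter, Multiset.mem_toFinset, Multiset.mem_lists_iff]
  exact and_congr_left fun _ => eq_comm

theorem rotate_mem_words {M : Multiset ℕ} {j : ℕ} {w : List ℕ} (h : w ∈ words M j) (i : ℕ) :
    w.rotate i ∈ words M j := by
  rw [mem_words] at h ⊢
  refine ⟨?_, h.2.1.rotate i, (cycDes_rotate w i).trans h.2.2⟩
  rw [← h.1, Multiset.coe_eq_coe]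
  exact rotate_perm w i

theorem length_of_mem_words {M : Multiset ℕ} {j : ℕ} {w : List ℕ} (h : w ∈ words M j) :
    w.length = M.card := by
  rw [← (mem_words.1 h).1, Multiset.coe_card]

theorem card_mul_card_descentAtSeam (M : Multiset ℕ) (j : ℕ) :
    M.card * ((words M j).filter DescentAtSeam).card = j * (words M j).card := by
  rw [length_mul_card_filter fun w hw i => rotate_mem_words hw i, mul_comm j,
    ← smul_eq_mul, ← Finset.sum_const]
  refine Finset.sum_congr rfl fun w hw => ?_
  rw [← length_of_mem_words hw, card_descentAtSeam]
  exact (mem_words.1 hw).2.2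

theorem card_mul_card_not_descentAtSeam (M : Multiset ℕ) (j : ℕ) :
    M.card * ((words M j).filter fun w => ¬ DescentAtSeam w).card =
      (M.card - j) * (words M j).card := by
  have h1 := card_mul_card_descentAtSeam M j
  have h2 := Finset.card_filter_add_card_filter_not (s := words M j) DescentAtSeam
  rw [Nat.sub_mul, ← h1, ← h2, mul_add]
  omega

theorem words_eq_empty {M : Multiset ℕ} {j : ℕ} (h : M.card < j) : words M j = ∅ := by
  refine Finset.eq_empty_of_forall_notMem fun w hw => ?_
  have := cycDes_le_length w
  rw [length_of_mem_words hw, (mem_words.1 hw).2.2] at this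
  omega

/-- A letter occurring exactly once may be rotated to the front in exactly one way. -/
theorem card_mul_card_head {a : ℕ} {M : Multiset ℕ} (ha : a ∉ M) (j : ℕ) :
    (M.card + 1) * ((words (a ::ₘ M) j).filter fun w => ∃ v, w = a :: v).card =
      (words (a ::ₘ M) j).card := by
  refine length_mul_card_filter_of_unique (fun w hw i => rotate_mem_words hw i) _ ?_
  intro w hw
  have hlen := length_of_mem_words hw
  rw [Multiset.card_cons] at hlen
  have hM := (mem_words.1 hw).1
  have haw : a ∈ w := by
    rw [← Multiset.mem_coe, hM]; exact Multiset.mem_cons_self a M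
  obtain ⟨u, v, rfl⟩ := mem_iff_append.1 haw
  refine ⟨u.length, ⟨?_, v ++ u, ?_⟩, ?_⟩
  · rw [← hlen]; simp
  · rw [rotate_append_length_eq]; simp
  · rintro i ⟨hi, t, ht⟩
    have hnd : ((u ++ a :: v).count a) = 1 := by
      rw [← Multiset.coe_count, hM, Multiset.count_cons_self, Multiset.count_eq_zero_of_notMem ha]
    rw [← hlen] at hi
    have hget : (u ++ a :: v)[i]'hi = a := by
      have := congrArg head? ht
      rw [head?_rotate hi] at this
      simpa [getElem?_eq_getElem hi] using this
    have hu : a ∉ u := by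
      intro h
      have := count_pos_iff.2 h
      simp at hnd
      omega
    have hv : a ∉ v := by
      intro h
      have := count_pos_iff.2 h
      simp at hnd
      omega
    rcases Nat.lt_trichotomy i u.length with h | h | h
    · rw [getElem_append_left h] at hget
      exact absurd (hget ▸ getElem_mem h) hu
    · exact h
    · rw [getElem_append_right h.le, getElem_cons, dif_neg (by omega)] at hget
      exact absurd (hget ▸ getElem_mem _) hv

/-- The noncrossing words with letter multiset `M` having `j` linear descents. -/
noncomputable def linWords (M : Multiset ℕ) (j : ℕ) : Finset (List ℕ) :=
  M.lists.toFinset.filter fun w => Noncrossing w ∧ linDes w = j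

theorem mem_linWords {M : Multiset ℕ} {j : ℕ} {w : List ℕ} :
    w ∈ linWords M j ↔ (w : Multiset ℕ) = M ∧ Noncrossing w ∧ linDes w = j := by
  rw [linWords, Finset.mem_filter, Multiset.mem_toFinset, Multiset.mem_lists_iff]
  exact and_congr_left fun _ => eq_comm

theorem cycDes_eq_linDes_add {u : List ℕ} (hu : u ≠ []) :
    cycDes u = linDes u + if DescentAtSeam u then 1 else 0 := by
  have : u.take 1 = [u.getD 0 0] := by
    cases u with
    | nil => exact absurd rfl hu
    | cons a u => simp
  rw [cycDes, this, linDes_concat u hu]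
  congr

theorem card_linWords {M : Multiset ℕ} (hM : M ≠ 0) (j : ℕ) :
    (linWords M j).card = ((words M (j + 1)).filter DescentAtSeam).card +
      ((words M j).filter fun w => ¬ DescentAtSeam w).card := by
  have hne : ∀ w : List ℕ, (w : Multiset ℕ) = M → w ≠ [] := by
    rintro w rfl rfl
    exact hM rfl
  rw [← Finset.card_filter_add_card_filter_not (s := linWords M j) DescentAtSeam]
  congr 2 <;> ext w <;> simp only [Finset.mem_filter, mem_words, mem_linWords] <;>
    refine and_congr_left fun hs => and_congr_right fun hw => and_congr_right fun _ => ?_ <;>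
    rw [cycDes_eq_linDes_add (hne w hw)] <;> simp [hs]

theorem card_mul_card_linWords {M : Multiset ℕ} (hM : M ≠ 0) (j : ℕ) :
    M.card * (linWords M j).card =
      (j + 1) * (words M (j + 1)).card + (M.card - j) * (words M j).card := by
  rw [card_linWords hM, mul_add, card_mul_card_descentAtSeam, card_mul_card_not_descentAtSeam]

theorem noncrossing_cons_of_notMem {a : ℕ} {u : List ℕ} (ha : a ∉ u) :
    Noncrossing (a :: u) ↔ Noncrossing u := by
  have h := noncrossing_insert_disjoint (p := []) (u := [a]) (q := u) (by simp) (by simpa using ha)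
  have h1 : Noncrossing [a] := fun x y hxy => absurd hxy.length_le (by simp)
  simpa [h1] using h

theorem card_words_cons {a : ℕ} {M : Multiset ℕ} (ha : a ∉ M)
    (hdes : ∀ u : List ℕ, (u : Multiset ℕ) = M → cycDes (a :: u) = linDes u + 1) (j : ℕ) :
    (words (a ::ₘ M) (j + 1)).card = (M.card + 1) * (linWords M j).card := by
  rw [← card_mul_card_head ha]
  congr 1
  symm
  refine Finset.card_bij (fun u _ => a :: u) ?_ (fun u _ v _ h => (cons.inj h).2) ?_
  · intro u hu
    obtain ⟨h1, h2, h3⟩ := mem_linWords.1 hu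
    have hau : a ∉ u := by rwa [← Multiset.mem_coe, h1]
    rw [Finset.mem_filter, mem_words, noncrossing_cons_of_notMem hau, hdes u h1,
      ← Multiset.cons_coe, h1, h3]
    exact ⟨⟨rfl, h2, rfl⟩, u, rfl⟩
  · intro w hw
    obtain ⟨hw, u, rfl⟩ := Finset.mem_filter.1 hw
    obtain ⟨h1, h2, h3⟩ := mem_words.1 hw
    rw [← Multiset.cons_coe, Multiset.cons_inj_right] at h1
    have hau : a ∉ u := by rwa [← Multiset.mem_coe, h1]
    rw [noncrossing_cons_of_notMem hau] at h2
    rw [hdes u h1] at h3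
    exact ⟨u, mem_linWords.2 ⟨h1, h2, by omega⟩, rfl⟩

theorem words_cons_zero {a : ℕ} {M : Multiset ℕ}
    (hdes : ∀ u : List ℕ, (u : Multiset ℕ) = M → cycDes (a :: u) = linDes u + 1)
    (ha : a ∉ M) : (words (a ::ₘ M) 0).card = 0 := by
  rw [← card_mul_card_head ha, Finset.filter_false_of_mem, Finset.card_empty, mul_zero]
  rintro w hw ⟨u, rfl⟩
  obtain ⟨h1, h2, h3⟩ := mem_words.1 hw
  rw [← Multiset.cons_coe, Multiset.cons_inj_right] at h1
  rw [hdes u h1] at h3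
  omega

theorem cycDes_cons_of_max {a : ℕ} {u : List ℕ} (hu : u ≠ []) (h : ∀ x ∈ u, x < a) :
    cycDes (a :: u) = linDes u + 1 := by
  have hl := h _ (getLastD_mem hu)
  have h1 : (a :: u).getLastD 0 = u.getLastD 0 := by
    cases u with
    | nil => exact absurd rfl hu
    | cons b u => rw [getLastD_cons, getLastD_cons, getLastD_cons]
  rw [cycDes_eq_linDes_add (by simp), DescentAtSeam, h1, linDes_cons_of_max hu h]
  simp [-getLastD_eq_getLast?, hl.le]

theorem cycDes_zero_cons {u : List ℕ} (hu : u ≠ []) (h : ∀ x ∈ u, 0 < x) :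
    cycDes (0 :: u) = linDes u + 1 := by
  have hl := h _ (getLastD_mem hu)
  have h1 : (0 :: u).getLastD 0 = u.getLastD 0 := getLastD_cons ..
  rw [cycDes_eq_linDes_add (by simp), DescentAtSeam, h1, linDes_cons_zero]
  simp [-getLastD_eq_getLast?, hl]

/-- Every occurrence of `0` comes after every occurrence of `a`, and `a` is the first letter. -/
def Split (a : ℕ) (w : List ℕ) : Prop := ∃ v, w = a :: v ∧ ¬ [0, a] <+ v

theorem pair_sublist_append {x y : ℕ} {u v : List ℕ} (hx : x ∈ u) (hy : y ∈ v) :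
    [x, y] <+ u ++ v :=
  (singleton_sublist.2 hx).append (singleton_sublist.2 hy)

theorem existsUnique_split {a : ℕ} (ha : 0 < a) {w : List ℕ} (hw : Noncrossing w)
    (h0 : 0 ∈ w) (haw : a ∈ w) : ∃! i, i < w.length ∧ Split a (w.rotate i) := by
  refine existsUnique_of_exists_of_unique ?_ ?_
  · obtain ⟨p, q, rfl⟩ := mem_iff_append.1 h0
    have hrot : (p ++ 0 :: q).rotate p.length = 0 :: q ++ p := by
      rw [rotate_append_length_eq]
    have hmem : a ∈ 0 :: q ++ p := by
      rw [← hrot]; exact mem_rotate.2 haw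
    obtain ⟨s, t, hst, has⟩ := eq_append_cons_of_mem hmem
    have h0s : 0 ∈ s := by
      cases s with
      | nil => simp at hst; omega
      | cons b s => simp at hst; simp [hst.1]
    have hnc := hw.rotate p.length
    rw [hrot, hst] at hnc
    have hsplit : Split a ((p ++ 0 :: q).rotate (p.length + s.length)) := by
      rw [← rotate_rotate, hrot, hst, rotate_append_length_eq]
      refine ⟨t ++ s, rfl, fun h => ?_⟩
      have hat : [0, a] <+ t := by
        obtain ⟨l₁, l₂, he, h1, h2⟩ := sublist_append_iff.1 h
        rcases l₁ with _ | ⟨x, _ | ⟨y, l₁⟩⟩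
        · rw [nil_append] at he
          subst he
          exact absurd (h2.subset (by simp)) has
        · simp only [cons_append, nil_append, cons.injEq] at he
          rw [← he.2] at h2
          exact absurd (h2.subset (by simp)) has
        · simp only [cons_append, cons.injEq, nil_eq, append_eq_nil_iff] at he
          obtain ⟨rfl, rfl, rfl, rfl⟩ := he
          exact h1
      exact ha.ne (hnc 0 a ((singleton_sublist.2 h0s).append (hat.cons_cons a)))
    have hlt : 0 < (p ++ 0 :: q).length := by simp
    exact ⟨_, Nat.mod_lt _ hlt, by rwa [rotate_mod]⟩
  · have key : ∀ i j, i < j → j < w.length → Split a (w.rotate i) → Split a (w.rotate j) →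
        False := by
      intro i j hij hj hi hj'
      have e : w.rotate j = (w.rotate i).rotate (j - i) := by
        rw [rotate_rotate, Nat.add_sub_cancel' hij.le]
      have hlen : j - i < (w.rotate i).length := by rw [length_rotate]; omega
      have h0' : 0 ∈ w.rotate i := mem_rotate.2 h0
      rw [e, rotate_eq_drop_append_take hlen.le] at hj'
      have e2 := take_append_drop (j - i) (w.rotate i)
      have n1 : (w.rotate i).take (j - i) ≠ [] := by
        rw [← length_pos_iff, length_take]; omega
      have n2 : (w.rotate i).drop (j - i) ≠ [] := by
        rw [← length_pos_iff, length_drop]; omega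
      generalize (w.rotate i).take (j - i) = u at *
      generalize (w.rotate i).drop (j - i) = v at *
      rw [← e2] at hi h0'
      obtain ⟨x, u, rfl⟩ := exists_cons_of_ne_nil n1
      obtain ⟨y, v, rfl⟩ := exists_cons_of_ne_nil n2
      obtain ⟨s, hs, hs'⟩ := hi
      obtain ⟨t, ht, ht'⟩ := hj'
      simp only [cons_append, cons.injEq] at hs ht
      obtain ⟨rfl, rfl⟩ := hs
      obtain ⟨rfl, rfl⟩ := ht
      rcases mem_append.1 h0' with h | h
      · rcases mem_cons.1 h with h | h
        · omega
        · exact hs' (pair_sublist_append h (by simp))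
      · rcases mem_cons.1 h with h | h
        · omega
        · exact ht' (pair_sublist_append h (by simp))
    rintro i j ⟨hi, hi'⟩ ⟨hj, hj'⟩
    rcases Nat.lt_trichotomy i j with h | h | h
    · exact (key i j h hj hi' hj').elim
    · exact h
    · exact (key j i h hi hj' hi').elim

theorem card_mul_card_split {a : ℕ} (ha : 0 < a) {M : Multiset ℕ} (h0 : 0 ∈ M) (haM : a ∈ M)
    (j : ℕ) : M.card * ((words M j).filter (Split a)).card = (words M j).card := by
  refine length_mul_card_filter_of_unique (fun w hw i => rotate_mem_words hw i) _ ?_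
  intro w hw
  rw [← length_of_mem_words hw]
  obtain ⟨h1, h2, -⟩ := mem_words.1 hw
  refine existsUnique_split ha h2 ?_ ?_ <;> rwa [← Multiset.mem_coe, h1]

theorem append_cons_inj {x : ℕ} {p p' s s' : List ℕ} (hp : x ∉ p) (hp' : x ∉ p')
    (h : p ++ x :: s = p' ++ x :: s') : p = p' ∧ s = s' := by
  induction p generalizing p' with
  | nil =>
    cases p' with
    | nil => exact ⟨rfl, (cons.inj h).2⟩
    | cons b p' => exact absurd (by simp [(cons.inj h).1]) hp'
  | cons a p ih =>
    cases p' with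
    | nil => exact absurd (by simp [(cons.inj h).1]) hp
    | cons b p' =>
      simp only [cons_append, cons.injEq] at h
      obtain ⟨rfl, h⟩ := h
      obtain ⟨rfl, rfl⟩ := ih (fun hx => hp (mem_cons_of_mem a hx))
        (fun hx => hp' (mem_cons_of_mem a hx)) h
      exact ⟨rfl, rfl⟩

/-- The three blocks into which a word splits when the letter `a` closes its first block `p`
immediately and the first `0` separates `q` from `r`. -/
def Blocks (a : ℕ) (t : List ℕ × List ℕ × List ℕ) : Prop :=
  (a ∉ t.1 ∧ 0 ∉ t.1) ∧ 0 ∉ t.2.1 ∧ a ∉ t.2.2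

/-- The word in which the block `p` is enclosed by two copies of `a`. -/
def joinTop (a : ℕ) (t : List ℕ × List ℕ × List ℕ) : List ℕ :=
  a :: (t.1 ++ a :: (t.2.1 ++ 0 :: t.2.2))

/-- The word in which the block `p` is enclosed by two copies of `0`. -/
def joinBot (a : ℕ) (t : List ℕ × List ℕ × List ℕ) : List ℕ :=
  a :: (t.2.1 ++ 0 :: (t.1 ++ 0 :: t.2.2))

theorem joinTop_injOn (a : ℕ) : Set.InjOn (joinTop a) {t | Blocks a t} := by
  rintro ⟨p, q, r⟩ ⟨⟨hp, -⟩, hq, -⟩ ⟨p', q', r'⟩ ⟨⟨hp', -⟩, hq', -⟩ h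
  obtain ⟨rfl, h⟩ := append_cons_inj hp hp' (cons.inj h).2
  obtain ⟨rfl, h⟩ := append_cons_inj hq hq' h
  subst h
  rfl

theorem joinBot_injOn (a : ℕ) : Set.InjOn (joinBot a) {t | Blocks a t} := by
  rintro ⟨p, q, r⟩ ⟨⟨-, hp⟩, hq, -⟩ ⟨p', q', r'⟩ ⟨⟨-, hp'⟩, hq', -⟩ h
  obtain ⟨rfl, h⟩ := append_cons_inj hq hq' (cons.inj h).2
  obtain ⟨rfl, h⟩ := append_cons_inj hp hp' h
  subst h
  rfl

theorem pair_sublist_append_of_notMem {x y : ℕ} {u v : List ℕ} (hx : x ∉ u) :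
    [x, y] <+ u ++ v ↔ [x, y] <+ v := by
  refine ⟨fun h => ?_, fun h => h.trans (sublist_append_right u v)⟩
  obtain ⟨l₁, l₂, he, h1, h2⟩ := sublist_append_iff.1 h
  cases l₁ with
  | nil => rw [nil_append] at he; rwa [he]
  | cons b l =>
    rw [cons_append, cons.injEq] at he
    exact absurd (h1.subset (by simp [he.1])) hx

theorem zero_pair_sublist_zero_cons {a : ℕ} {v : List ℕ} :
    [0, a] <+ 0 :: v ↔ a ∈ v := by
  rw [cons_sublist_cons, singleton_sublist]

theorem split_joinTop {a : ℕ} (ha : 0 < a) {t : List ℕ × List ℕ × List ℕ} (h : Blocks a t) :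
    Split a (joinTop a t) := by
  obtain ⟨p, q, r⟩ := t
  obtain ⟨⟨h1, h2⟩, h3, h4⟩ := h
  refine ⟨_, rfl, ?_⟩
  have h5 : 0 ∉ p ++ a :: q := by
    simp only [mem_append, mem_cons, not_or]
    exact ⟨h2, ha.ne, h3⟩
  have e : p ++ a :: (q ++ 0 :: r) = (p ++ a :: q) ++ 0 :: r := by simp
  simp only [e]
  rwa [pair_sublist_append_of_notMem h5, zero_pair_sublist_zero_cons]

theorem split_joinBot {a : ℕ} (ha : 0 < a) {t : List ℕ × List ℕ × List ℕ} (h : Blocks a t) :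
    Split a (joinBot a t) := by
  obtain ⟨p, q, r⟩ := t
  obtain ⟨⟨h1, h2⟩, h3, h4⟩ := h
  refine ⟨_, rfl, ?_⟩
  rw [pair_sublist_append_of_notMem h3, zero_pair_sublist_zero_cons]
  simp only [mem_append, mem_cons, not_or]
  exact ⟨h1, ha.ne', h4⟩

theorem exists_blocks_joinTop {a : ℕ} (ha : 0 < a) {v : List ℕ} (hv : ¬ [0, a] <+ v)
    (hav : a ∈ v) (h0v : 0 ∈ v) : ∃ t, Blocks a t ∧ joinTop a t = a :: v := by
  obtain ⟨p, s, rfl, hp⟩ := eq_append_cons_of_mem hav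
  have h0p : 0 ∉ p := fun h => hv (pair_sublist_append h (by simp))
  have h0s : 0 ∈ s := by
    simp only [mem_append, mem_cons] at h0v
    grind
  obtain ⟨q, r, rfl, hq⟩ := eq_append_cons_of_mem h0s
  refine ⟨(p, q, r), ⟨⟨hp, h0p⟩, hq, fun har => hv ?_⟩, rfl⟩
  have := pair_sublist_append (x := 0) (y := a) (u := p ++ a :: (q ++ [0])) (v := r) (by simp) har
  simpa using this

theorem exists_blocks_joinBot {a : ℕ} {v : List ℕ} (hv : ¬ [0, a] <+ v)
    (h0v : 2 ≤ v.count 0) : ∃ t, Blocks a t ∧ joinBot a t = a :: v := by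
  obtain ⟨q, s, rfl, hq⟩ := eq_append_cons_of_mem (count_pos_iff.1 (by omega : 0 < v.count 0))
  have h0s : 0 ∈ s := by
    rw [count_append, count_eq_zero_of_not_mem hq, count_cons_self] at h0v
    exact count_pos_iff.1 (by omega)
  obtain ⟨p, r, rfl, hp⟩ := eq_append_cons_of_mem h0s
  have hpr : a ∉ p ++ 0 :: r := fun h => hv <| by
    have := pair_sublist_append (x := 0) (y := a) (u := q ++ [0]) (by simp) h
    simpa using this
  simp only [mem_append, mem_cons, not_or] at hpr
  exact ⟨(p, q, r), ⟨⟨hpr.1, hp⟩, hq, hpr.2.2⟩, rfl⟩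

theorem noncrossing_joinTop_iff {a : ℕ} {p q r : List ℕ} (hap : a ∉ p) (h0p : 0 ∉ p)
    (hq : ∀ x ∈ p, x ∉ q) (hr : ∀ x ∈ p, x ∉ r) :
    Noncrossing (joinTop a (p, q, r)) ↔ Noncrossing p ∧ Noncrossing (a :: (q ++ 0 :: r)) := by
  have h := noncrossing_insert_disjoint (p := [a]) (u := p) (q := a :: (q ++ 0 :: r))
    (fun x hx => by simp; rintro rfl; exact hap hx)
    (fun x hx => by
      simp only [mem_cons, mem_append, not_or]
      exact ⟨fun e => hap (e ▸ hx), hq x hx, fun e => h0p (e ▸ hx), hr x hx⟩)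
  exact h.trans (and_congr_right fun _ => noncrossing_dup (p := []))

theorem noncrossing_joinBot_iff {a : ℕ} {p q r : List ℕ} (hap : a ∉ p) (h0p : 0 ∉ p)
    (hq : ∀ x ∈ p, x ∉ q) (hr : ∀ x ∈ p, x ∉ r) :
    Noncrossing (joinBot a (p, q, r)) ↔ Noncrossing p ∧ Noncrossing (a :: (q ++ 0 :: r)) := by
  have h := noncrossing_insert_disjoint (p := a :: (q ++ [0])) (u := p) (q := 0 :: r)
    (fun x hx => by
      simp only [mem_cons, mem_append, not_or]
      exact ⟨fun e => hap (e ▸ hx), hq x hx, fun e => h0p (e ▸ hx), not_mem_nil⟩)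
    (fun x hx => by
      simp only [mem_cons, not_or]
      exact ⟨fun e => h0p (e ▸ hx), hr x hx⟩)
  have h' := noncrossing_dup (p := a :: q) (q := r) (a := 0)
  simp only [cons_append, append_assoc, nil_append] at h h'
  exact h.trans (and_congr_right fun _ => h')

theorem noncrossing_joinTop_iff_joinBot {a : ℕ} {t : List ℕ × List ℕ × List ℕ}
    (ht : Blocks a t) : Noncrossing (joinTop a t) ↔ Noncrossing (joinBot a t) := by
  obtain ⟨p, q, r⟩ := t
  obtain ⟨⟨hap, h0p⟩, -, -⟩ := ht
  simp only at hap h0p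
  have hne : ∀ x ∈ p, x ≠ a ∧ x ≠ 0 := fun x hx => ⟨fun e => hap (e ▸ hx), fun e => h0p (e ▸ hx)⟩
  have htop : Noncrossing (joinTop a (p, q, r)) → ∀ x ∈ p, x ∉ q ∧ x ∉ r := by
    intro h x hx
    have : x ∉ q ++ 0 :: r := fun hy => (hne x hx).1.symm <| h a x <|
      ((singleton_sublist.2 hx).append ((singleton_sublist.2 hy).cons_cons a)).cons_cons a
    simp only [mem_append, mem_cons, not_or] at this
    exact ⟨this.1, this.2.2⟩
  have hbot : Noncrossing (joinBot a (p, q, r)) → ∀ x ∈ p, x ∉ q ∧ x ∉ r := by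
    intro h x hx
    constructor
    · intro hy
      refine (hne x hx).2 (h x 0 (Sublist.cons a ?_))
      exact (singleton_sublist.2 hy).append (((singleton_sublist.2 hx).append
        ((nil_sublist r).cons_cons 0)).cons_cons 0)
    · intro hy
      refine (hne x hx).2.symm (h 0 x (Sublist.cons a ?_))
      exact (nil_sublist q).append (((singleton_sublist.2 hx).append
        ((singleton_sublist.2 hy).cons_cons 0)).cons_cons 0)
  constructor
  · intro h
    have hq := fun x hx => (htop h x hx).1
    have hr := fun x hx => (htop h x hx).2
    exact (noncrossing_joinBot_iff hap h0p hq hr).2 ((noncrossing_joinTop_iff hap h0p hq hr).1 h)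
  · intro h
    have hq := fun x hx => (hbot h x hx).1
    have hr := fun x hx => (hbot h x hx).2
    exact (noncrossing_joinTop_iff hap h0p hq hr).2 ((noncrossing_joinBot_iff hap h0p hq hr).1 h)

theorem cycDes_joinTop {a : ℕ} {t : List ℕ × List ℕ × List ℕ} (ha : ∀ x ∈ t.1, x < a)
    (h0 : ∀ x ∈ t.1, 0 < x) : cycDes (joinTop a t) = cycDes (joinBot a t) := by
  obtain ⟨p, q, r⟩ := t
  have e1 := linDes_split (a :: p) a (q ++ 0 :: (r ++ [a]))
  have e2 := linDes_split (a :: q) 0 (r ++ [a])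
  have e3 := linDes_split (a :: q) 0 (p ++ 0 :: (r ++ [a]))
  have e4 := linDes_split (0 :: p) 0 (r ++ [a])
  have e5 := linDes_surround ha h0
  simp only [cycDes, joinTop, joinBot, take_succ_cons, take_zero, cons_append, append_assoc]
    at e1 e2 e3 e4 e5 ⊢
  omega

theorem coe_joinTop {a : ℕ} {t : List ℕ × List ℕ × List ℕ} {N : Multiset ℕ} :
    (joinTop a t : Multiset ℕ) = a ::ₘ N ↔ (joinBot a t : Multiset ℕ) = 0 ::ₘ N := by
  obtain ⟨p, q, r⟩ := t
  have e1 : (joinTop a (p, q, r) : Multiset ℕ) = a ::ₘ (a ::ₘ 0 ::ₘ (p + q + r : Multiset ℕ)) := by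
    simp only [joinTop, ← Multiset.cons_coe, ← Multiset.coe_add, Multiset.add_cons]
    simp only [add_assoc]
  have e2 : (joinBot a (p, q, r) : Multiset ℕ) = 0 ::ₘ (a ::ₘ 0 ::ₘ (p + q + r : Multiset ℕ)) := by
    simp only [joinBot, ← Multiset.cons_coe, ← Multiset.coe_add, Multiset.add_cons]
    rw [Multiset.cons_swap a 0, add_left_comm, add_assoc]
  rw [e1, e2, Multiset.cons_inj_right, Multiset.cons_inj_right]

theorem joinTop_mem_words_iff {a : ℕ} {t : List ℕ × List ℕ × List ℕ} {N : Multiset ℕ}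
    (hN : ∀ x ∈ N, x ≤ a) (ht : Blocks a t) (j : ℕ) :
    joinTop a t ∈ words (a ::ₘ N) j ↔ joinBot a t ∈ words (0 ::ₘ N) j := by
  rw [mem_words, mem_words, coe_joinTop, noncrossing_joinTop_iff_joinBot ht]
  refine and_congr_right fun h => and_congr_right fun _ => ?_
  have hle : ∀ x ∈ t.1, x ≤ a := fun x hx => by
    have : x ∈ 0 ::ₘ N := by rw [← h]; simp [joinBot, hx]
    rcases Multiset.mem_cons.1 this with rfl | h
    · exact Nat.zero_le a
    · exact hN x h
  rw [cycDes_joinTop]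
  · exact fun x hx => (hle x hx).lt_of_ne fun e => ht.1.1 (e ▸ hx)
  · exact fun x hx => Nat.pos_of_ne_zero fun e => ht.1.2 (e ▸ hx)

theorem card_words_cons_max_eq_cons_zero {a : ℕ} {N : Multiset ℕ} (ha : 0 < a) (h0 : 0 ∈ N)
    (haN : a ∈ N) (hN : ∀ x ∈ N, x ≤ a) (j : ℕ) :
    (words (a ::ₘ N) j).card = (words (0 ::ₘ N) j).card := by
  rw [← card_mul_card_split ha (M := a ::ₘ N) (by simp [h0]) (by simp),
    ← card_mul_card_split ha (M := 0 ::ₘ N) (by simp) (by simp [haN]),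
    Multiset.card_cons, Multiset.card_cons]
  congr 1
  have e1 : ((words (a ::ₘ N) j).filter (Split a) : Set (List ℕ)) =
      joinTop a '' {t | Blocks a t ∧ joinTop a t ∈ words (a ::ₘ N) j} := by
    ext w
    simp only [Finset.coe_filter, Set.mem_ofPred_eq, Set.mem_image]
    constructor
    · rintro ⟨hw, v, rfl, hv⟩
      have hvN := (mem_words.1 hw).1
      rw [← Multiset.cons_coe, Multiset.cons_inj_right] at hvN
      obtain ⟨t, ht, e⟩ := exists_blocks_joinTop ha hv (by rwa [← Multiset.mem_coe, hvN])
        (by rwa [← Multiset.mem_coe, hvN])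
      exact ⟨t, ⟨ht, e ▸ hw⟩, e⟩
    · rintro ⟨t, ⟨ht, hw⟩, rfl⟩
      exact ⟨hw, split_joinTop ha ht⟩
  have e2 : ((words (0 ::ₘ N) j).filter (Split a) : Set (List ℕ)) =
      joinBot a '' {t | Blocks a t ∧ joinTop a t ∈ words (a ::ₘ N) j} := by
    ext w
    simp only [Finset.coe_filter, Set.mem_ofPred_eq, Set.mem_image]
    constructor
    · rintro ⟨hw, v, rfl, hv⟩
      have hvN := congrArg (Multiset.count 0) (mem_words.1 hw).1
      rw [← Multiset.cons_coe, Multiset.count_cons_self, Multiset.count_cons_of_ne ha.ne,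
        Multiset.coe_count] at hvN
      have h2 := Multiset.count_pos.2 h0
      obtain ⟨t, ht, e⟩ := exists_blocks_joinBot hv (by omega)
      exact ⟨t, ⟨ht, (joinTop_mem_words_iff hN ht j).2 (e ▸ hw)⟩, e⟩
    · rintro ⟨t, ⟨ht, hw⟩, rfl⟩
      exact ⟨(joinTop_mem_words_iff hN ht j).1 hw, split_joinBot ha ht⟩
  rw [← Set.ncard_coe_finset, ← Set.ncard_coe_finset, e1, e2,
    ((joinTop_injOn a).mono fun t h => h.1).ncard_image,
    ((joinBot_injOn a).mono fun t h => h.1).ncard_image]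

theorem card_words_replicate_max {a : ℕ} {M : Multiset ℕ} (hM : ∀ x ∈ M, x < a) (c k j : ℕ)
    (ha : 0 < a) :
    (words (Multiset.replicate (c + 1) 0 + (Multiset.replicate (k + 1) a + M)) j).card =
      (words (a ::ₘ (Multiset.replicate (c + k + 1) 0 + M)) j).card := by
  induction k generalizing c with
  | zero => simp [Multiset.add_cons]
  | succ k ih =>
    have h := card_words_cons_max_eq_cons_zero ha (j := j)
      (N := Multiset.replicate (c + 1) 0 + (Multiset.replicate (k + 1) a + M))
      (by simp) (by simp) (by
        intro x hx
        simp only [Multiset.mem_add, Multiset.mem_replicate] at hx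
        rcases hx with ⟨-, rfl⟩ | ⟨-, rfl⟩ | hx
        · exact Nat.zero_le a
        · exact le_rfl
        · exact (hM x hx).le)
    rw [Multiset.replicate_succ a (k + 1), Multiset.cons_add, Multiset.add_cons, h,
      ← Multiset.cons_add, ← Multiset.replicate_succ, ih (c + 1),
      show c + (k + 1) = c + 1 + k by omega]

/-- A log-concave sequence whose zeros, apart from an initial one, form a final segment. -/
structure IsGood (f : ℕ → ℕ) : Prop where
  mul_le : ∀ j, f j * f (j + 2) ≤ f (j + 1) ^ 2
  eq_zero : ∀ j, f (j + 1) = 0 → f (j + 2) = 0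

theorem IsGood.mul_le' {f : ℕ → ℕ} (hf : IsGood f) (j : ℕ) :
    f j * f (j + 3) ≤ f (j + 1) * f (j + 2) := by
  have h1 := hf.mul_le j
  have h2 := hf.mul_le (j + 1)
  have z1 := hf.eq_zero j
  have z2 := hf.eq_zero (j + 1)
  rcases Nat.eq_zero_or_pos (f (j + 1)) with h | h
  · simp [z2 (z1 h)]
  rcases Nat.eq_zero_or_pos (f (j + 2)) with h' | h'
  · simp [z2 h']
  refine Nat.le_of_mul_le_mul_right ?_ (Nat.mul_pos h h')
  calc f j * f (j + 3) * (f (j + 1) * f (j + 2))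
      = (f j * f (j + 2)) * (f (j + 1) * f (j + 3)) := by ring
    _ ≤ f (j + 1) ^ 2 * f (j + 2) ^ 2 := Nat.mul_le_mul h1 h2
    _ = f (j + 1) * f (j + 2) * (f (j + 1) * f (j + 2)) := by ring

theorem IsGood.of_recurrence {f g : ℕ → ℕ} {L : ℕ} (hf : IsGood f) (hL : 0 < L)
    (hfL : ∀ j, L < j → f j = 0) (g0 : g 0 = 0)
    (hg : ∀ j, L * g (j + 1) = (L + 1) * ((j + 1) * f (j + 1) + (L - j) * f j)) : IsGood g := by
  constructor
  · rintro (_ | i)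
    · simp [g0]
    refine le_of_mul_le_mul_left (a := L * L) ?_ (Nat.mul_pos hL hL)
    have e1 := hg i
    have e2 := hg (i + 1)
    have e3 := hg (i + 2)
    have l1 := hf.mul_le i
    have l2 := hf.mul_le (i + 1)
    have l3 := hf.mul_le' i
    simp only [add_assoc, Nat.reduceAdd] at e1 e2 e3 l1 l2 l3 ⊢
    suffices h : L * g (i + 1) * (L * g (i + 3)) ≤ (L * g (i + 2)) ^ 2 by
      calc _ = L * g (i + 1) * (L * g (i + 3)) := by ring
        _ ≤ _ := h
        _ = _ := by ring
    rw [e1, e2, e3]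
    rcases Nat.lt_or_ge L (i + 2) with h | h
    · simp [hfL _ h, hfL (i + 3) (by omega)]
    obtain ⟨m, rfl⟩ := Nat.exists_eq_add_of_le h
    rw [show i + 2 + m - i = m + 2 by omega, show i + 2 + m - (i + 1) = m + 1 by omega,
      show i + 2 + m - (i + 2) = m by omega]
    generalize f i = u at *
    generalize f (i + 1) = v at *
    generalize f (i + 2) = w at *
    generalize f (i + 3) = x at *
    suffices h : ((i + 1) * v + (m + 2) * u) * ((i + 3) * x + m * w) ≤
        ((i + 2) * w + (m + 1) * v) ^ 2 by
      calc _ = (i + 2 + m + 1) ^ 2 *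
            (((i + 1) * v + (m + 2) * u) * ((i + 3) * x + m * w)) := by ring
        _ ≤ (i + 2 + m + 1) ^ 2 * ((i + 2) * w + (m + 1) * v) ^ 2 := Nat.mul_le_mul_left _ h
        _ = _ := by ring
    have k1 := Nat.mul_le_mul_left (m * (m + 2)) l1
    have k2 := Nat.mul_le_mul_left ((i + 1) * (i + 3)) l2
    have k3 := Nat.mul_le_mul_left ((m + 2) * (i + 3)) l3
    zify at k1 k2 k3 ⊢
    nlinarith [sq_nonneg ((w : ℤ) - v)]
  · intro j h
    have e1 := hg j
    have e2 := hg (j + 1)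
    rw [h, mul_zero] at e1
    have h1 : f (j + 1) = 0 := by
      have := (Nat.mul_eq_zero.1 e1.symm).resolve_left (Nat.succ_ne_zero L)
      exact (Nat.mul_eq_zero.1 (Nat.add_eq_zero_iff.1 this).1).resolve_left (Nat.succ_ne_zero j)
    rw [h1, hf.eq_zero j h1, mul_zero, mul_zero, add_zero, mul_zero] at e2
    exact (Nat.mul_eq_zero.1 e2).resolve_left hL.ne'

theorem linDes_eq_zero {w : List ℕ} (h : ∀ x ∈ w, x = 0) : linDes w = 0 := by
  induction w with
  | nil => rfl
  | cons a u ih =>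
    rw [h a (by simp), linDes_cons_zero]
    exact ih fun x hx => h x (mem_cons_of_mem a hx)

theorem isGood_words_replicate_zero (c : ℕ) :
    IsGood fun j => (words (Multiset.replicate c 0) j).card := by
  have h : ∀ j, (words (Multiset.replicate c 0) (j + 1)).card = 0 := by
    intro j
    rw [Finset.card_eq_zero]
    refine Finset.eq_empty_of_forall_notMem fun w hw => ?_
    obtain ⟨h1, -, h3⟩ := mem_words.1 hw
    have h0 : ∀ x ∈ w, x = 0 := fun x hx => by
      rw [← Multiset.mem_coe, h1] at hx
      exact Multiset.eq_of_mem_replicate hx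
    rw [cycDes, linDes_eq_zero] at h3
    · omega
    · intro x hx
      rcases mem_append.1 hx with hx | hx
      · exact h0 x hx
      · exact h0 x (mem_of_mem_take hx)
  exact ⟨fun j => by simp [h], fun j _ => h (j + 1)⟩

theorem isGood_words_cons {a : ℕ} {M : Multiset ℕ} (hM : ∀ x ∈ M, x < a) (hM0 : M ≠ 0)
    (h : IsGood fun j => (words M j).card) : IsGood fun j => (words (a ::ₘ M) j).card := by
  have ha : a ∉ M := fun h => (hM a h).false
  have hdes : ∀ u : List ℕ, (u : Multiset ℕ) = M → cycDes (a :: u) = linDes u + 1 := by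
    rintro u rfl
    exact cycDes_cons_of_max (fun e => hM0 (by rw [e]; rfl)) hM
  refine h.of_recurrence (Multiset.card_pos.2 hM0) (fun j hj => ?_) (words_cons_zero hdes ha)
    fun j => ?_
  · simp [words_eq_empty hj]
  · rw [card_words_cons ha hdes, ← card_mul_card_linWords hM0]
    ring

theorem mem_sum_replicate {n : ℕ} {k : ℕ → ℕ} {x : ℕ}
    (hx : x ∈ ∑ i ∈ Finset.Icc 1 n, Multiset.replicate (k i) i) : x ∈ Finset.Icc 1 n := by
  obtain ⟨i, hi, hxi⟩ := Multiset.mem_sum.1 hx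
  rwa [Multiset.eq_of_mem_replicate hxi]

theorem isGood_words {n : ℕ} {k : ℕ → ℕ} (hk : ∀ i ∈ Finset.Icc 1 n, 1 ≤ k i) (c : ℕ) :
    IsGood fun j => (words (Multiset.replicate (c + 1) 0 +
      ∑ i ∈ Finset.Icc 1 n, Multiset.replicate (k i) i) j).card := by
  induction n generalizing c with
  | zero => simpa using isGood_words_replicate_zero (c + 1)
  | succ n ih =>
    obtain ⟨l, hl⟩ := Nat.exists_eq_add_of_le' (hk (n + 1) (by simp))
    have hlt : ∀ x ∈ ∑ i ∈ Finset.Icc 1 n, Multiset.replicate (k i) i, x < n + 1 := fun x hx => by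
      have := Finset.mem_Icc.1 (mem_sum_replicate hx)
      omega
    simp only [Finset.sum_Icc_succ_top (Nat.le_add_left 1 n), hl, add_comm (Finset.sum _ _),
      card_words_replicate_max hlt _ _ _ n.succ_pos]
    refine isGood_words_cons (fun x hx => ?_) (by simp [Multiset.replicate_succ])
      (ih (fun i hi => hk i ?_) (c + l))
    · rcases Multiset.mem_add.1 hx with hx | hx
      · rw [Multiset.eq_of_mem_replicate hx]
        exact n.succ_pos
      · exact hlt x hx
    · simp only [Finset.mem_Icc] at hi ⊢
      omega

theorem quasiStirling_iff_sublist {w : List ℕ} :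
    QuasiStirling w ↔ ∀ x y, ¬ [x, y, x, y] <+ w := by
  rw [QuasiStirling, ← not_iff_not, not_not]
  push Not
  constructor
  · rintro ⟨i, j, k, l, hij, hjk, hkl, hl, h1, h2⟩
    refine ⟨w.getD i 0, w.getD j 0, ?_⟩
    have hi : [w.getD i 0] <+ w.take (i + 1) := by
      rw [singleton_sublist, getD_eq_getElem _ _ (by omega)]
      exact mem_take_iff_getElem.2 ⟨i, by omega, rfl⟩
    have hmid : ∀ p q, p < q → q < w.length → [w.getD q 0] <+ (w.take (q + 1)).drop (p + 1) := by
      intro p q hpq hq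
      rw [singleton_sublist, getD_eq_getElem _ _ hq]
      refine mem_drop_iff_getElem.2 ⟨q - (p + 1), by simp; omega, ?_⟩
      rw [getElem_take]
      congr 1
      omega
    have snoc : ∀ (s : List ℕ) p q, p < q → q < w.length → s <+ w.take (p + 1) →
        s ++ [w.getD q 0] <+ w.take (q + 1) := by
      intro s p q hpq hq hs
      rw [← take_append_drop (p + 1) (w.take (q + 1)), take_take, min_eq_left (by omega)]
      exact hs.append (hmid p q hpq hq)
    have := snoc _ k l hkl hl (snoc _ j k hjk (by omega) (snoc _ i j hij (by omega) hi))
    rw [← h1, ← h2] at this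
    exact this.trans (take_sublist _ _)
  · rintro ⟨x, y, h⟩
    obtain ⟨f, hf⟩ := sublist_iff_exists_fin_orderEmbedding_get_eq.1 h
    have hf' : ∀ i, w.getD (f i) 0 = [x, y, x, y].get i := fun i => by
      rw [hf, getD_eq_getElem _ _ (f i).2]
      rfl
    refine ⟨f ⟨0, by simp⟩, f ⟨1, by simp⟩, f ⟨2, by simp⟩, f ⟨3, by simp⟩, ?_, ?_, ?_,
      (f _).2, ?_, ?_⟩
    · exact f.strictMono (by simp)
    · exact f.strictMono (by simp)
    · exact f.strictMono (by simp)
    · rw [hf', hf']; rfl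
    · rw [hf', hf']; rfl

theorem quasiStirling_iff {w : List ℕ} :
    QuasiStirling w ↔ Noncrossing w ∧ ∀ x, w.count x < 4 := by
  rw [quasiStirling_iff_sublist]
  constructor
  · refine fun h => ⟨fun x y hxy => absurd hxy (h x y), fun x => ?_⟩
    by_contra! hx
    exact h x x (replicate_sublist_iff.2 hx)
  · rintro ⟨h1, h2⟩ x y hxy
    obtain rfl := h1 x y hxy
    exact (h2 x).not_ge (replicate_sublist_iff.1 hxy)

theorem mem_qsPerms {M : Multiset ℕ} {w : List ℕ} :
    w ∈ qsPerms M ↔ (w : Multiset ℕ) = M ∧ QuasiStirling w := by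
  rw [qsPerms, Finset.mem_filter, mem_toFinset, mem_permutations, ← Multiset.coe_eq_coe,
    Multiset.coe_toList]

theorem qCount_eq_card_linWords {M : Multiset ℕ} (hM : ∀ x, M.count x < 4) (j : ℕ) :
    qCount M (j + 1) = (linWords M j).card := by
  rw [qCount]
  congr 1
  ext w
  rw [Finset.mem_filter, mem_qsPerms, mem_linWords, quasiStirling_iff, des_eq_linDes, and_assoc]
  refine and_congr_right ?_
  rintro rfl
  simp only [Multiset.coe_count] at hM
  simp [hM]

theorem qCount_eq_zero {M : Multiset ℕ} {x : ℕ} (hx : 4 ≤ M.count x) (j : ℕ) :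
    qCount M j = 0 := by
  rw [qCount, Finset.card_eq_zero]
  refine Finset.eq_empty_of_forall_notMem fun w hw => ?_
  obtain ⟨rfl, h⟩ := mem_qsPerms.1 (Finset.mem_filter.1 hw).1
  rw [Multiset.coe_count] at hx
  exact ((quasiStirling_iff.1 h).2 x).not_ge hx

theorem qCount_zero (M : Multiset ℕ) : qCount M 0 = 0 := by
  simp [qCount, des]

end QuasiStirlingWords

/-- the coefficients of `Q̄_M(t)` are log-concave. -/
theorem quasiStirling_coeffs_log_concave
    (n : ℕ) (hn : 1 ≤ n) (k : ℕ → ℕ) (hk : ∀ i ∈ Finset.Icc 1 n, 1 ≤ k i)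
    (M : Multiset ℕ) (hM : M = ∑ i ∈ Finset.Icc 1 n, Multiset.replicate (k i) i) :
    ∀ j : ℕ, 1 ≤ j → qCount M (j - 1) * qCount M (j + 1) ≤ qCount M j ^ 2 := by
  open QuasiStirlingWords in
  rintro (_ | _ | j) hj
  · omega
  · simp [qCount_zero]
  by_cases h4 : ∀ x, M.count x < 4
  · have hpos : ∀ x ∈ M, 0 < x := fun x hx => by
      rw [hM] at hx
      exact (Finset.mem_Icc.1 (mem_sum_replicate hx)).1
    have hM0 : M ≠ 0 := by
      intro h
      have h1 : 1 ∈ Finset.Icc 1 n := by simpa using hn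
      rw [hM, Finset.sum_eq_zero_iff] at h
      have h2 := congrArg Multiset.card (h 1 h1)
      rw [Multiset.card_replicate, Multiset.card_zero] at h2
      exact absurd (hk 1 h1) (by omega)
    have hcount : ∀ i, (words (0 ::ₘ M) (i + 1)).card = (M.card + 1) * qCount M (i + 1) := by
      intro i
      rw [qCount_eq_card_linWords h4]
      refine card_words_cons (fun h => (hpos 0 h).false) ?_ i
      rintro u rfl
      exact cycDes_zero_cons (fun e => hM0 (by rw [e]; rfl)) hpos
    have h := (isGood_words hk 0).mul_le (j + 1)
    rw [← hM] at h
    simp only [zero_add, Multiset.replicate_one, Multiset.singleton_add, hcount] at h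
    refine le_of_mul_le_mul_left (a := (M.card + 1) ^ 2) ?_ (by positivity)
    calc _ = (M.card + 1) * qCount M (j + 1) * ((M.card + 1) * qCount M (j + 3)) := by
          simp only [add_tsub_cancel_right]; ring
      _ ≤ _ := h
      _ = _ := by ring
  · push Not at h4
    obtain ⟨x, hx⟩ := h4
    simp [qCount_eq_zero hx]
end

section
/- For any multiset M = {1^{k_1}, 2^{k_2}, …, n^{k_n}} with each k_i ≥ 1, the coefficient sequence of the quasi-Stirling polynomial Q̄_M(t) is unimodal: writing q_j for the number of quasi-Stirling permutations π of M with des(π) = j, there exists an index j₀ such that q_0 ≤ q_1 ≤ ⋯ ≤ q_{j₀} and q_{j₀} ≥ q_{j₀+1} ≥ ⋯ ≥ q_K. -/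
open scoped Classical

/-- The number of descents of a word. -/
def descents : List ℕ → ℕ
  | [] => 0
  | [_] => 0
  | x :: y :: t => (if y < x then 1 else 0) + descents (y :: t)

/-- The number of descents of a word read cyclically. -/
def cyclicDescents : List ℕ → ℕ
  | [] => 0
  | x :: t => descents (x :: t ++ [x])

/-- A word is noncrossing if it has no subword `cdcd` with `c ≠ d`. -/
def Noncrossing (w : List ℕ) : Prop :=
  ∀ c d, c ≠ d → ¬ [c, d, c, d].Sublist w

/-- The noncrossing words with content `M` and `d` descents. -/
def linearWords (M : Multiset ℕ) (d : ℕ) : Set (List ℕ) :=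
  {w | (w : Multiset ℕ) = M ∧ Noncrossing w ∧ descents w = d}

/-- The noncrossing words with content `M` and `d` cyclic descents. -/
def cyclicWords (M : Multiset ℕ) (d : ℕ) : Set (List ℕ) :=
  {w | (w : Multiset ℕ) = M ∧ Noncrossing w ∧ cyclicDescents w = d}

theorem finite_words (M : Multiset ℕ) : {w : List ℕ | (w : Multiset ℕ) = M}.Finite := by
  refine (M.toList.permutations.toFinset.finite_toSet).subset fun w hw => ?_
  simp only [Set.mem_ofPred_eq] at hw
  simp [List.mem_permutations, ← Multiset.coe_eq_coe, hw]

theorem finite_cyclicWords (M : Multiset ℕ) (d : ℕ) : (cyclicWords M d).Finite :=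
  (finite_words M).subset fun _ hw => hw.1

theorem descents_append (u v : List ℕ) (x : ℕ) :
    descents (u ++ x :: v) = descents (u ++ [x]) + descents (x :: v) := by
  induction u with
  | nil => simp [descents]
  | cons y u ih =>
    cases u with
    | nil => simp [descents]
    | cons z u =>
      simp only [List.cons_append, descents] at ih ⊢
      omega

theorem cyclicDescents_rotate_one (w : List ℕ) :
    cyclicDescents (w.rotate 1) = cyclicDescents w := by
  rcases w with _ | ⟨x, _ | ⟨y, t⟩⟩
  · rfl
  · simp
  · have h := descents_append (y :: t) [y] x
    simp [cyclicDescents, descents] at h ⊢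
    omega

theorem Noncrossing.rotate_one {w : List ℕ} (h : Noncrossing w) : Noncrossing (w.rotate 1) := by
  rcases w with _ | ⟨x, t⟩
  · simpa using h
  · intro c d hcd hs
    simp only [List.rotate_cons_succ, List.rotate_zero] at hs
    obtain ⟨l₁, l₂, he, h₁, h₂⟩ := List.sublist_append_iff.1 hs
    have hl : l₂ = [] ∨ l₂ = [x] := by
      rcases l₂ with _ | ⟨y, _ | ⟨z, l₂⟩⟩
      · simp
      · simp at h₂; simp [h₂]
      · simpa using h₂.length_le
    rcases hl with rfl | rfl
    · rw [List.append_nil] at he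
      exact h c d hcd (he ▸ h₁.cons x)
    · have he' : [c, d, c] ++ [d] = l₁ ++ [x] := he
      obtain ⟨rfl, h3⟩ := List.append_inj' he' rfl
      simp at h3
      subst h3
      exact h d c hcd.symm (List.cons_sublist_cons.2 h₁)

theorem rotate_mem_cyclicWords {M : Multiset ℕ} {d : ℕ} {w : List ℕ}
    (hw : w ∈ cyclicWords M d) (i : ℕ) : w.rotate i ∈ cyclicWords M d := by
  induction i with
  | zero => simpa using hw
  | succ i ih =>
    rw [← List.rotate_rotate]
    refine ⟨?_, ih.2.1.rotate_one, (cyclicDescents_rotate_one _).trans ih.2.2⟩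
    rw [← ih.1]
    exact Multiset.coe_eq_coe.2 (List.rotate_perm _ _)

theorem exists_append_of_isRotated {l l' : List ℕ} (h : l ~r l') :
    ∃ u v, l = u ++ v ∧ l' = v ++ u := by
  obtain ⟨n, hn, rfl⟩ := List.isRotated_iff_mod.1 h
  exact ⟨l.take n, l.drop n, by simp, List.rotate_eq_drop_append_take hn⟩

theorem ncard_le_of_rotation {S P Q : Set (List ℕ)} (hS : S.Finite)
    (hrot : ∀ w ∈ S, ∀ i, w.rotate i ∈ S)
    (hP : ∀ w ∈ S, ∀ w' ∈ S, w ∈ P → w' ∈ P → w ~r w' → w = w')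
    (hQ : ∀ w ∈ S, ∃ w', w ~r w' ∧ w' ∈ Q) :
    (S ∩ P).ncard ≤ (S ∩ Q).ncard := by
  choose! f hf hfQ using hQ
  refine Set.ncard_le_ncard_of_injOn f (fun w hw => ⟨?_, hfQ w hw.1⟩) ?_ (hS.inter_of_left _)
  · obtain ⟨i, hi⟩ := hf w hw.1
    exact hi ▸ hrot w hw.1 i
  · intro w hw w' hw' h
    refine hP w hw.1 w' hw'.1 hw.2 hw'.2 ((hf w hw.1).trans ?_)
    rw [h]
    exact (hf w' hw'.1).symm

/-- Words that begin with `a` and in which some `b` occurs after the last `a`. -/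
def startsRun (a b : ℕ) : Set (List ℕ) :=
  {w | ∃ u v, w = a :: u ++ b :: v ∧ a ∉ v}

theorem exists_rotation_head {w : List ℕ} {a : ℕ} (h : a ∈ w) : ∃ t, w ~r (a :: t) := by
  obtain ⟨u, v, rfl⟩ := List.append_of_mem h
  exact ⟨v ++ u, by simpa using List.isRotated_append (l := u) (l' := a :: v)⟩

theorem exists_rotation_startsRun {w : List ℕ} {a b : ℕ} (hab : a ≠ b) (ha : a ∈ w) (hb : b ∈ w) :
    ∃ w', w ~r w' ∧ w' ∈ startsRun a b := by
  obtain ⟨t, ht⟩ := exists_rotation_head hb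
  have hat : a ∈ t := by
    have := ht.mem_iff.1 ha
    simpa [hab] using this
  obtain ⟨v, u, rfl, hv⟩ := List.eq_append_cons_of_mem hat
  refine ⟨a :: u ++ b :: v, ht.trans ?_, u, v, rfl, hv⟩
  simpa using List.isRotated_append (l := b :: v) (l' := a :: u)

theorem eq_of_isRotated_startsRun {w w' : List ℕ} {a b : ℕ} (hab : a ≠ b) (hw : Noncrossing w)
    (h : w ∈ startsRun a b) (h' : w' ∈ startsRun a b) (hr : w ~r w') : w = w' := by
  obtain ⟨U, V, rfl, rfl⟩ := exists_append_of_isRotated hr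
  rcases U with _ | ⟨x, U⟩
  · simp
  rcases V with _ | ⟨y, V⟩
  · simp
  obtain ⟨u, v, h, hv⟩ := h
  obtain ⟨u', v', h', hv'⟩ := h'
  simp only [List.cons_append, List.cons.injEq] at h h'
  obtain ⟨rfl, h⟩ := h
  obtain ⟨rfl, h'⟩ := h'
  have key : ∀ {A B u v : List ℕ}, A ++ y :: B = u ++ b :: v → y ∉ v → [b].Sublist B := by
    intro A B u v he hv
    rcases List.append_eq_append_iff.1 he with ⟨c, h1, h2⟩ | ⟨c, h1, h2⟩
    · rcases c with _ | ⟨z, c⟩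
      · simp at h2; exact absurd h2.1 hab
      · simp at h2; simp [h2.2]
    · rcases c with _ | ⟨z, c⟩
      · simp at h2; exact absurd h2.1.symm hab
      · simp at h2; simp [h2.2] at hv
  have h1 := key h hv
  have h2 := key h' hv'
  refine absurd ?_ (hw y b hab)
  exact (List.cons_sublist_cons.2 h2).append (List.cons_sublist_cons.2 h1)

theorem noncrossing_insert_iff {U X V : List ℕ} (hX : ∀ x ∈ X, x ∉ U ++ V) :
    Noncrossing (U ++ X ++ V) ↔ Noncrossing X ∧ Noncrossing (U ++ V) := by
  have hsub : (U ++ V).Sublist (U ++ X ++ V) := by simp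
  have hsubX : X.Sublist (U ++ X ++ V) := by
    rw [List.append_assoc]
    exact (List.sublist_append_left X V).trans (List.sublist_append_right U _)
  refine ⟨fun h => ⟨fun c d hcd hs => h c d hcd (hs.trans hsubX),
    fun c d hcd hs => h c d hcd (hs.trans hsub)⟩, fun ⟨h1, h2⟩ c d hcd hs => ?_⟩
  by_cases hc : c ∈ X <;> by_cases hd : d ∈ X
  · have := hs.filter (fun x => decide (x ∈ X))
    have e1 : U.filter (fun x => decide (x ∈ X)) = [] := by
      rw [List.filter_eq_nil_iff]; intro x hx hxX
      exact hX x (by simpa using hxX) (by simp [hx])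
    have e2 : V.filter (fun x => decide (x ∈ X)) = [] := by
      rw [List.filter_eq_nil_iff]; intro x hx hxX
      exact hX x (by simpa using hxX) (by simp [hx])
    rw [List.filter_append, List.filter_append, e1, e2] at this
    simp [hc, hd] at this
    exact h1 c d hcd (this.trans List.filter_sublist)
  · obtain ⟨l, l₃, he, h12, h3⟩ := List.sublist_append_iff.1 hs
    obtain ⟨l₁, l₂, rfl, h1', h2'⟩ := List.sublist_append_iff.1 h12
    have m1 : c ∉ l₁ := fun h => hX c hc (by simp [h1'.subset h])
    have m3 : c ∉ l₃ := fun h => hX c hc (by simp [h3.subset h])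
    have m2 : d ∉ l₂ := fun h => hd (h2'.subset h)
    rcases l₁ with _ | ⟨x, l₁⟩
    · rcases l₂ with _ | ⟨x, _ | ⟨y, l₂⟩⟩ <;> simp at he <;> grind
    · simp at he; grind
  · obtain ⟨l, l₃, he, h12, h3⟩ := List.sublist_append_iff.1 hs
    obtain ⟨l₁, l₂, rfl, h1', h2'⟩ := List.sublist_append_iff.1 h12
    have m1 : d ∉ l₁ := fun h => hX d hd (by simp [h1'.subset h])
    have m3 : d ∉ l₃ := fun h => hX d hd (by simp [h3.subset h])
    have m2 : c ∉ l₂ := fun h => hc (h2'.subset h)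
    rcases l₁ with _ | ⟨x, _ | ⟨y, l₁⟩⟩
    · rcases l₂ with _ | ⟨x, l₂⟩ <;> simp at he <;> grind
    · rcases l₂ with _ | ⟨x, _ | ⟨y, l₂⟩⟩ <;> simp at he <;> grind
    · simp at he; grind
  · have := hs.filter (fun x => decide (x ∉ X))
    have e0 : X.filter (fun x => decide (x ∉ X)) = [] := by
      rw [List.filter_eq_nil_iff]; simp
    have e1 : U.filter (fun x => decide (x ∉ X)) = U := by
      rw [List.filter_eq_self]; intro x hx
      simpa using fun hxX => hX x hxX (by simp [hx])
    have e2 : V.filter (fun x => decide (x ∉ X)) = V := by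
      rw [List.filter_eq_self]; intro x hx
      simpa using fun hxX => hX x hxX (by simp [hx])
    rw [List.filter_append, List.filter_append, e0, e1, e2] at this
    simp only [hc, hd, List.filter_cons, not_false_eq_true, decide_true, if_true, List.filter_nil,
      List.append_nil] at this
    exact h2 c d hcd this

theorem noncrossing_double_iff {U V : List ℕ} {x : ℕ} :
    Noncrossing (U ++ x :: x :: V) ↔ Noncrossing (U ++ x :: V) := by
  refine ⟨fun h c d hcd hs => h c d hcd (hs.trans ?_), fun h c d hcd hs => h c d hcd ?_⟩
  · exact (List.Sublist.refl U).append ((List.sublist_cons_self x V).cons_cons x)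
  · obtain ⟨l₁, l₂, he, h1, h2⟩ := List.sublist_append_iff.1 hs
    rw [he]
    refine h1.append ?_
    rcases l₂ with _ | ⟨y, _ | ⟨z, l₂⟩⟩
    · simp
    · simpa using h2
    · have hyz : y ≠ z := by
        rcases l₁ with _ | ⟨_, _ | ⟨_, _ | ⟨_, l₁⟩⟩⟩ <;> simp at he <;> grind
      rcases List.sublist_cons_iff.1 h2 with h2 | ⟨r, hr, h2⟩
      · exact h2
      · simp at hr
        obtain ⟨rfl, rfl⟩ := hr
        rcases List.sublist_cons_iff.1 h2 with h2 | ⟨r, hr, h2⟩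
        · exact List.cons_sublist_cons.2 h2
        · simp at hr; exact absurd hr.1.symm hyz

theorem exists_eq_append_cons_last {l : List ℕ} {a : ℕ} (h : a ∈ l) :
    ∃ u v, l = u ++ a :: v ∧ a ∉ v := by
  obtain ⟨u, v, he, hu⟩ := List.eq_append_cons_of_mem (List.mem_reverse.2 h)
  refine ⟨v.reverse, u.reverse, ?_, by simpa using hu⟩
  simpa using congrArg List.reverse he

theorem append_cons_inj_last {u v u' v' : List ℕ} {a : ℕ} (h : u ++ a :: v = u' ++ a :: v')
    (hv : a ∉ v) (hv' : a ∉ v') : u = u' ∧ v = v' := by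
  rcases List.append_eq_append_iff.1 h with ⟨c, h1, h2⟩ | ⟨c, h1, h2⟩ <;>
    rcases c with _ | ⟨z, c⟩ <;> simp_all

theorem append_cons_inj_first {u v u' v' : List ℕ} {a : ℕ} (h : u ++ a :: v = u' ++ a :: v')
    (hu : a ∉ u) (hu' : a ∉ u') : u = u' ∧ v = v' := by
  rcases List.append_eq_append_iff.1 h with ⟨c, h1, h2⟩ | ⟨c, h1, h2⟩ <;>
    rcases c with _ | ⟨z, c⟩ <;> simp_all

theorem noncrossing_block_first_iff {a b : ℕ} {X R W : List ℕ} (haX : a ∉ X) :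
    Noncrossing (a :: X ++ a :: R ++ b :: W) ↔
      (∀ x ∈ X, x ∉ a :: R ++ b :: W) ∧ Noncrossing X ∧ Noncrossing (a :: R ++ b :: W) := by
  have key (hX : ∀ x ∈ X, x ∉ a :: R ++ b :: W) : Noncrossing (a :: X ++ a :: R ++ b :: W) ↔
      Noncrossing X ∧ Noncrossing (a :: R ++ b :: W) := by
    have h1 := noncrossing_insert_iff (U := [a]) (X := X) (V := a :: R ++ b :: W)
      fun x hx => by
        have := hX x hx
        simp at this ⊢
        tauto
    have h2 := noncrossing_double_iff (U := []) (V := R ++ b :: W) (x := a)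
    simp at h1 h2 ⊢
    rw [h1, h2]
  refine ⟨fun h => ?_, fun h => (key h.1).2 h.2⟩
  have hX : ∀ x ∈ X, x ∉ a :: R ++ b :: W := by
    intro x hx hmem
    have hxa : x ≠ a := fun h => haX (h ▸ hx)
    have hmem' : x ∈ R ++ b :: W := by simpa [hxa] using hmem
    refine h a x hxa.symm ?_
    have h1 : [x].Sublist X := List.singleton_sublist.2 hx
    have h2 : [x].Sublist (R ++ b :: W) := List.singleton_sublist.2 hmem'
    simpa using ((h1.append (h2.cons_cons a)).cons_cons a)
  exact ⟨hX, (key hX).1 h⟩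

theorem noncrossing_block_last_iff {a b : ℕ} {X R W : List ℕ} (hbX : b ∉ X) :
    Noncrossing (a :: R ++ b :: X ++ b :: W) ↔
      (∀ x ∈ X, x ∉ a :: R ++ b :: W) ∧ Noncrossing X ∧ Noncrossing (a :: R ++ b :: W) := by
  have key (hX : ∀ x ∈ X, x ∉ a :: R ++ b :: W) : Noncrossing (a :: R ++ b :: X ++ b :: W) ↔
      Noncrossing X ∧ Noncrossing (a :: R ++ b :: W) := by
    have h1 := noncrossing_insert_iff (U := a :: R ++ [b]) (X := X) (V := b :: W)
      fun x hx => by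
        have := hX x hx
        simp at this ⊢
        tauto
    have h2 := noncrossing_double_iff (U := a :: R) (V := W) (x := b)
    simp at h1 h2 ⊢
    rw [h1, h2]
  refine ⟨fun h => ?_, fun h => (key h.1).2 h.2⟩
  have hX : ∀ x ∈ X, x ∉ a :: R ++ b :: W := by
    intro x hx hmem
    have hxb : x ≠ b := fun h => hbX (h ▸ hx)
    have h1 : [x].Sublist X := List.singleton_sublist.2 hx
    have hmem' : x ∈ a :: R ∨ x ∈ W := by
      simp [hxb] at hmem ⊢
      tauto
    rcases hmem' with hm | hm
    · have h2 : [x].Sublist (a :: R) := List.singleton_sublist.2 hm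
      refine h x b hxb ?_
      have := ((h2.append (h1.cons_cons b)).append ((List.nil_sublist W).cons_cons b))
      simpa using this
    · have h2 : [x].Sublist W := List.singleton_sublist.2 hm
      refine h b x hxb.symm ?_
      have := (((List.nil_sublist (a :: R)).append (h1.cons_cons b)).append (h2.cons_cons b))
      simpa using this
  exact ⟨hX, (key hX).1 h⟩

theorem descents_append_singleton_succ {X : List ℕ} {a : ℕ} (ha : a ∉ X) (hb : a + 1 ∉ X) :
    descents (X ++ [a]) = descents (X ++ [a + 1]) := by
  induction X with
  | nil => rfl
  | cons x X ih =>
    simp only [List.mem_cons, not_or] at ha hb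
    have := ih ha.2 hb.2
    cases X with
    | nil =>
      have : a < x ↔ a + 1 < x := by omega
      simp [descents, this]
    | cons y X => simpa [descents] using this

theorem descents_block_succ {X : List ℕ} {a : ℕ} (ha : a ∉ X) (hb : a + 1 ∉ X) :
    descents (a :: X ++ [a]) = descents ((a + 1) :: X ++ [a + 1]) := by
  have := descents_append_singleton_succ ha hb
  cases X with
  | nil => simp [descents]
  | cons x X =>
    simp only [List.mem_cons, not_or] at ha hb
    have hx : x < a ↔ x < a + 1 := by omega
    simp only [List.cons_append, descents] at this ⊢
    simp only [this, hx]

theorem cyclicDescents_move_block {X R W : List ℕ} {a : ℕ} (ha : a ∉ X) (hb : a + 1 ∉ X) :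
    cyclicDescents (a :: X ++ a :: R ++ (a + 1) :: W) =
      cyclicDescents (a :: R ++ (a + 1) :: X ++ (a + 1) :: W) := by
  have h := descents_block_succ ha hb
  have h1 := descents_append (a :: X) (R ++ (a + 1) :: W ++ [a]) a
  have h2 := descents_append (a :: R) (W ++ [a]) (a + 1)
  have h3 := descents_append (a :: R) (X ++ (a + 1) :: W ++ [a]) (a + 1)
  have h4 := descents_append ((a + 1) :: X) (W ++ [a]) (a + 1)
  simp [cyclicDescents] at h h1 h2 h3 h4 ⊢
  omega

/-- The data `(X, R, W)` common to the words `aXaRbW` and `aRbXbW`. -/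
def blockTriples (a b : ℕ) (N : Multiset ℕ) (d : ℕ) : Set (List ℕ × List ℕ × List ℕ) :=
  {p | ((∀ x ∈ p.1, x ∉ a :: p.2.1 ++ b :: p.2.2) ∧ Noncrossing p.1 ∧
      Noncrossing (a :: p.2.1 ++ b :: p.2.2)) ∧ a ∉ p.2.2 ∧ b ∉ p.2.2 ∧
    ((p.1 ++ (a :: p.2.1 ++ b :: p.2.2) : List ℕ) : Multiset ℕ) = N ∧
    cyclicDescents (a :: p.1 ++ a :: p.2.1 ++ b :: p.2.2) = d}

theorem exists_last_of_mem_startsRun {w : List ℕ} {a b : ℕ} (hw : w ∈ startsRun a b) :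
    ∃ u v, w = a :: u ++ b :: v ∧ a ∉ v ∧ b ∉ v := by
  obtain ⟨u, v, rfl, hv⟩ := hw
  obtain ⟨v₁, v₂, h, hb⟩ := exists_eq_append_cons_last (List.mem_cons_self (a := b) (l := v))
  refine ⟨u ++ v₁, v₂, by simp [h], fun hmem => ?_, hb⟩
  rcases v₁ with _ | ⟨y, v₁⟩
  · simp at h; exact hv (h ▸ hmem)
  · simp at h; exact hv (by simp [h.2, hmem])

theorem cyclicWords_first_eq {a b : ℕ} {N : Multiset ℕ} (d : ℕ) (ha : a ∈ N) (hab : a ≠ b) :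
    cyclicWords (a ::ₘ N) d ∩ startsRun a b =
      (fun p : List ℕ × List ℕ × List ℕ => a :: p.1 ++ a :: p.2.1 ++ b :: p.2.2) ''
        blockTriples a b N d := by
  ext w
  constructor
  · rintro ⟨⟨hN, hnc, hd⟩, hw⟩
    obtain ⟨u, W, rfl, haW, hbW⟩ := exists_last_of_mem_startsRun hw
    have hN' : ((u ++ b :: W : List ℕ) : Multiset ℕ) = N := by
      simpa [← Multiset.cons_coe] using hN
    have hau : a ∈ u := by
      rw [← hN'] at ha
      simpa [hab, haW] using ha
    obtain ⟨X, R, rfl, haX⟩ := List.eq_append_cons_of_mem hau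
    have hnc' : Noncrossing (a :: X ++ a :: R ++ b :: W) := by simpa using hnc
    exact ⟨(X, R, W), ⟨(noncrossing_block_first_iff haX).1 hnc', haW, hbW,
      by simpa using hN', by simpa using hd⟩, by simp⟩
  · rintro ⟨⟨X, R, W⟩, ⟨hT, haW, hbW, hN, hd⟩, rfl⟩
    have haX : a ∉ X := fun h => hT.1 a h (by simp)
    refine ⟨⟨?_, (noncrossing_block_first_iff haX).2 hT, hd⟩, X ++ a :: R, W, by simp, haW⟩
    rw [← hN]
    simp [← Multiset.cons_coe]

theorem cyclicWords_last_eq {a : ℕ} {N : Multiset ℕ} (d : ℕ) (hb : a + 1 ∈ N) :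
    cyclicWords ((a + 1) ::ₘ N) d ∩ startsRun a (a + 1) =
      (fun p : List ℕ × List ℕ × List ℕ => a :: p.2.1 ++ (a + 1) :: p.1 ++ (a + 1) :: p.2.2) ''
        blockTriples a (a + 1) N d := by
  have hab : a ≠ a + 1 := by omega
  ext w
  constructor
  · rintro ⟨⟨hN, hnc, hd⟩, hw⟩
    obtain ⟨u, W, rfl, haW, hbW⟩ := exists_last_of_mem_startsRun hw
    have hN' : ((a :: u ++ W : List ℕ) : Multiset ℕ) = N := by
      rw [← Multiset.cons_inj_right (a + 1), ← hN, Multiset.cons_coe, Multiset.coe_eq_coe]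
      exact (List.perm_middle (l₁ := a :: u)).symm
    have hbu : a + 1 ∈ u := by
      rw [← hN'] at hb
      simpa [hbW] using hb
    obtain ⟨R, X, rfl, hbX⟩ := exists_eq_append_cons_last hbu
    have hnc' : Noncrossing (a :: R ++ (a + 1) :: X ++ (a + 1) :: W) := by simpa using hnc
    have hT := (noncrossing_block_last_iff hbX).1 hnc'
    have haX : a ∉ X := fun h => hT.1 a h (by simp)
    refine ⟨(X, R, W), ⟨hT, haW, hbW, ?_, ?_⟩, by simp⟩
    · rw [← hN', Multiset.coe_eq_coe]
      simp only [List.perm_iff_count, List.count_append, List.count_cons]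
      intro x; ring
    · rw [← hd]
      simpa using cyclicDescents_move_block haX hbX
  · rintro ⟨⟨X, R, W⟩, ⟨hT, haW, hbW, hN, hd⟩, rfl⟩
    have haX : a ∉ X := fun h => hT.1 a h (by simp)
    have hbX : a + 1 ∉ X := fun h => hT.1 _ h (by simp)
    refine ⟨⟨?_, (noncrossing_block_last_iff hbX).2 hT, ?_⟩,
      R ++ (a + 1) :: X, W, by simp, haW⟩
    · rw [← hN, Multiset.cons_coe, Multiset.coe_eq_coe]
      simp only [List.perm_iff_count, List.count_append, List.count_cons]
      intro x; ring
    · rw [← hd]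
      exact (cyclicDescents_move_block haX hbX).symm

theorem ncard_cyclicWords_startsRun {a : ℕ} {N : Multiset ℕ} (d : ℕ) (ha : a ∈ N)
    (hb : a + 1 ∈ N) :
    (cyclicWords (a ::ₘ N) d ∩ startsRun a (a + 1)).ncard =
      (cyclicWords ((a + 1) ::ₘ N) d ∩ startsRun a (a + 1)).ncard := by
  rw [cyclicWords_first_eq d ha (by omega), cyclicWords_last_eq d hb, Set.InjOn.ncard_image,
    Set.InjOn.ncard_image]
  · rintro ⟨X, R, W⟩ ⟨hT, haW, hbW, -, -⟩ ⟨X', R', W'⟩ ⟨hT', haW', hbW', -, -⟩ h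
    dsimp only at h hT hT' hbW hbW'
    obtain ⟨h1, rfl⟩ := append_cons_inj_last h hbW hbW'
    obtain ⟨h2, rfl⟩ := append_cons_inj_last h1 (fun h => hT.1 _ h (by simp))
      (fun h => hT'.1 _ h (by simp))
    simpa using h2
  · rintro ⟨X, R, W⟩ ⟨hT, haW, hbW, -, -⟩ ⟨X', R', W'⟩ ⟨hT', haW', hbW', -, -⟩ h
    dsimp only at h hT hT' hbW hbW'
    obtain ⟨h1, rfl⟩ := append_cons_inj_last h hbW hbW'
    simp only [List.cons_append, List.cons.injEq, true_and] at h1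
    obtain ⟨rfl, rfl⟩ := append_cons_inj_first h1 (fun h => hT.1 _ h (by simp))
      (fun h => hT'.1 _ h (by simp))
    rfl

theorem noncrossing_cons_iff {w : List ℕ} {x : ℕ} (hx : x ∉ w) :
    Noncrossing (x :: w) ↔ Noncrossing w := by
  refine ⟨fun h c d hcd hs => h c d hcd (hs.cons x), fun h c d hcd hs => ?_⟩
  rcases List.sublist_cons_iff.1 hs with hs | ⟨r, hr, hs⟩
  · exact h c d hcd hs
  · simp at hr
    obtain ⟨rfl, rfl⟩ := hr
    exact hx (hs.subset (by simp))

theorem cyclicDescents_zero_cons {w : List ℕ} (hw : w ≠ []) (h0 : 0 ∉ w) :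
    cyclicDescents (0 :: w) = descents w + 1 := by
  obtain ⟨u, x, rfl⟩ := List.eq_nil_or_concat w |>.resolve_left hw
  have hx : 0 < x := Nat.pos_of_ne_zero fun h => h0 (by simp [h])
  have h1 := descents_append (0 :: u) [0] x
  have h2 : descents (0 :: (u ++ [x])) = descents (u ++ [x]) := by
    cases u <;> simp [descents]
  simp [cyclicDescents, descents, hx] at h1 h2 ⊢
  omega

theorem ncard_linearWords_eq {M : Multiset ℕ} (d : ℕ) (hM : M ≠ 0) (h0 : 0 ∉ M) :
    (linearWords M d).ncard =
      (cyclicWords (0 ::ₘ M) (d + 1) ∩ {w | ∃ t, w = 0 :: t}).ncard := by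
  rw [← Set.ncard_image_of_injective (linearWords M d) (List.cons_injective (a := 0))]
  congr 1
  ext w
  constructor
  · rintro ⟨t, ⟨rfl, hnc, rfl⟩, rfl⟩
    have h0' : 0 ∉ t := by simpa using h0
    exact ⟨⟨rfl, (noncrossing_cons_iff h0').2 hnc,
      cyclicDescents_zero_cons (by simpa using hM) h0'⟩, t, rfl⟩
  · rintro ⟨⟨hN, hnc, hd⟩, t, rfl⟩
    obtain rfl : (t : Multiset ℕ) = M := by simpa [← Multiset.cons_coe] using hN
    have h0' : 0 ∉ t := by simpa using h0
    rw [cyclicDescents_zero_cons (by simpa using hM) h0'] at hd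
    exact ⟨t, ⟨rfl, (noncrossing_cons_iff h0').1 hnc, by omega⟩, rfl⟩

theorem ncard_cyclicWords_zero_eq_startsRun {M : Multiset ℕ} {a b : ℕ} (d : ℕ) (h0 : 0 ∉ M)
    (hab : a ≠ b) (ha : a ∈ M) (hb : b ∈ M) :
    (cyclicWords (0 ::ₘ M) d ∩ {w | ∃ t, w = 0 :: t}).ncard =
      (cyclicWords (0 ::ₘ M) d ∩ startsRun a b).ncard := by
  have hmem {w : List ℕ} (hw : w ∈ cyclicWords (0 ::ₘ M) d) (x : ℕ) : x ∈ w ↔ x ∈ 0 ::ₘ M := by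
    rw [← hw.1, Multiset.mem_coe]
  have hfin := finite_cyclicWords (0 ::ₘ M) d
  have hrot : ∀ w ∈ cyclicWords (0 ::ₘ M) d, ∀ i, w.rotate i ∈ cyclicWords (0 ::ₘ M) d :=
    fun w hw i => rotate_mem_cyclicWords hw i
  apply le_antisymm
  · refine ncard_le_of_rotation hfin hrot ?_ fun w hw => exists_rotation_startsRun hab
      ((hmem hw a).2 (by simp [ha])) ((hmem hw b).2 (by simp [hb]))
    rintro w hw w' hw' ⟨t, rfl⟩ ⟨t', rfl⟩ hr
    have ht : 0 ∉ t := by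
      have : (t : Multiset ℕ) = M := by simpa [← Multiset.cons_coe] using hw.1
      rw [← this] at h0
      simpa using h0
    obtain ⟨u, v, h1, h2⟩ := exists_append_of_isRotated hr
    rcases u with _ | ⟨x, u⟩ <;> rcases v with _ | ⟨y, v⟩ <;> simp_all
  · refine ncard_le_of_rotation hfin hrot
      (fun w hw w' _ h h' hr => eq_of_isRotated_startsRun hab hw.2.1 h h' hr) fun w hw => ?_
    obtain ⟨t, ht⟩ := exists_rotation_head ((hmem hw 0).2 (by simp))
    exact ⟨_, ht, t, rfl⟩

/-- Replacing one copy of a letter by its successor does not change the descent distribution. -/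
theorem ncard_linearWords_succ {M : Multiset ℕ} {a : ℕ} (d : ℕ) (h0 : 0 ∉ M) (ha : a ∈ M)
    (hb : a + 1 ∈ M) :
    (linearWords ((a + 1) ::ₘ M) d).ncard = (linearWords (a ::ₘ M) d).ncard := by
  have ha0 : 0 ≠ a := fun h => h0 (h ▸ ha)
  have hab : a ≠ a + 1 := by omega
  rw [ncard_linearWords_eq d (by simp) (by simp [h0]),
    ncard_linearWords_eq d (by simp) (by simp [h0, ha0]),
    ncard_cyclicWords_zero_eq_startsRun _ (by simp [h0]) hab (by simp [ha]) (by simp),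
    ncard_cyclicWords_zero_eq_startsRun _ (by simp [h0, ha0]) hab (by simp) (by simp [hb]),
    Multiset.cons_swap, Multiset.cons_swap 0 a]
  exact (ncard_cyclicWords_startsRun _ (by simp [ha]) (by simp [hb])).symm

theorem mem_permutations'Aux_iff {b : ℕ} {s w : List ℕ} :
    w ∈ List.permutations'Aux b s ↔ ∃ u v, s = u ++ v ∧ w = u ++ b :: v := by
  induction s generalizing w with
  | nil => simp
  | cons y s ih =>
    simp only [List.permutations'Aux, List.mem_cons, List.mem_map, ih]
    constructor
    · rintro (rfl | ⟨_, ⟨u, v, rfl, rfl⟩, rfl⟩)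
      · exact ⟨[], y :: s, rfl, rfl⟩
      · exact ⟨y :: u, v, rfl, rfl⟩
    · rintro ⟨_ | ⟨z, u⟩, v, h, rfl⟩
      · simp_all
      · simp only [List.cons_append, List.cons.injEq] at h
        obtain ⟨rfl, rfl⟩ := h
        exact Or.inr ⟨_, ⟨u, v, rfl, rfl⟩, rfl⟩

theorem noncrossing_insert_singleton_iff {u v : List ℕ} {b : ℕ} (hb : b ∉ u ++ v) :
    Noncrossing (u ++ b :: v) ↔ Noncrossing (u ++ v) := by
  have h := noncrossing_insert_iff (U := u) (X := [b]) (V := v) (by simpa using hb)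
  have hs : Noncrossing [b] := fun c d _ hs => by simpa using hs.length_le
  simpa [hs] using h

theorem descents_le (w : List ℕ) : descents w ≤ w.length - 1 := by
  induction w with
  | nil => simp [descents]
  | cons x t ih =>
    cases t with
    | nil => simp [descents]
    | cons y t =>
      simp only [descents, List.length_cons] at ih ⊢
      split <;> omega

theorem count_map_descents_insert_tail (b d y : ℕ) (t : List ℕ) (hb : ∀ x ∈ y :: t, x < b) :
    ((List.permutations'Aux b t).map fun u => descents (y :: u)).count d =
      if d = descents (y :: t) then descents (y :: t) + 1
      else if d = descents (y :: t) + 1 then t.length - descents (y :: t) else 0 := by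
  induction t generalizing y d with
  | nil =>
    have : ¬ b < y := by have := hb y (by simp); omega
    simp only [List.permutations'Aux, List.map, descents, this, List.count_cons]
    simp
    grind
  | cons z t ih =>
    have hy : ¬ b < y := by have := hb y (by simp); omega
    have hz : z < b := hb z (by simp)
    have hrec : ∀ l : List (List ℕ),
        (l.map fun u => descents (y :: z :: u)) =
          (l.map fun u => descents (z :: u)).map ((if z < y then 1 else 0) + ·) := by
      intro l; simp [descents]
    have hle : descents (z :: t) ≤ t.length := descents_le (z :: t)
    have ih' := fun d => ih d z fun x hx => hb x (List.mem_cons_of_mem _ hx)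
    simp only [List.permutations'Aux, List.map_cons, List.map_map, Function.comp_def,
      List.count_cons, hrec]
    simp only [descents, hy, hz, if_true, if_false, List.length_cons, beq_iff_eq]
    by_cases hzy : z < y
    · simp only [hzy, if_true]
      rcases d with _ | d
      · have : List.count 0 (((List.permutations'Aux b t).map fun u => descents (z :: u)).map
            (1 + ·)) = 0 := by
          rw [List.count_eq_zero]; simp
        simp only [List.map_map, Function.comp_def] at this
        rw [this]
        grind
      · have := List.count_map_of_injective
          ((List.permutations'Aux b t).map fun u => descents (z :: u)) (1 + ·)
          (add_right_injective 1) d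
        simp only [List.map_map, Function.comp_def] at this
        rw [add_comm d 1, this, ih']
        grind
    · simp only [hzy, if_false, zero_add]
      rw [ih']
      grind

theorem count_map_descents_insert {b d : ℕ} {w : List ℕ} (hb : ∀ x ∈ w, x < b) (hw : w ≠ []) :
    ((List.permutations'Aux b w).map descents).count d =
      if d = descents w then descents w + 1
      else if d = descents w + 1 then w.length - descents w else 0 := by
  obtain ⟨y, t, rfl⟩ := List.exists_cons_of_ne_nil hw
  have hy : y < b := hb y (by simp)
  have h := count_map_descents_insert_tail b d y t hb
  have hle := descents_le (y :: t)
  simp only [List.permutations'Aux, List.map_cons, List.map_map, Function.comp_def,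
    List.count_cons, h]
  simp only [descents, hy, if_true, List.length_cons, beq_iff_eq] at hle ⊢
  grind

/-- Inserting a new largest letter, with multiplicity one. -/
theorem ncard_linearWords_insert {M : Multiset ℕ} {b : ℕ} (hM : M ≠ 0) (hb : ∀ x ∈ M, x < b)
    (d : ℕ) :
    (linearWords (b ::ₘ M) d).ncard = ∑ w ∈ (finite_words M).toFinset with Noncrossing w,
      if d = descents w then descents w + 1
      else if d = descents w + 1 then M.card - descents w else 0 := by
  have hset : linearWords (b ::ₘ M) d =
      (((finite_words M).toFinset.filter Noncrossing).biUnion fun w =>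
        ((List.permutations'Aux b w).filter fun u => descents u = d).toFinset : Finset (List ℕ)) := by
    ext x
    simp only [Finset.coe_biUnion, Set.mem_iUnion, Finset.mem_coe, Finset.mem_filter,
      Set.Finite.mem_toFinset, Set.mem_ofPred_eq, List.mem_toFinset, List.mem_filter,
      mem_permutations'Aux_iff, exists_prop, decide_eq_true_eq]
    have hperm (u v : List ℕ) : ((u ++ b :: v : List ℕ) : Multiset ℕ) = b ::ₘ M ↔
        ((u ++ v : List ℕ) : Multiset ℕ) = M := by
      rw [← Multiset.cons_inj_right b (s := ((u ++ v : List ℕ) : Multiset ℕ)), Multiset.cons_coe]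
      rw [Multiset.coe_eq_coe.2 (List.perm_middle (l₁ := u) (a := b) (l₂ := v))]
    have hnot {l : List ℕ} (h : (l : Multiset ℕ) = M) : b ∉ l := fun hmem =>
      (hb b (by rw [← h]; simpa using hmem)).false
    constructor
    · rintro ⟨h1, h2, h3⟩
      have hbx : b ∈ x := by rw [← Multiset.mem_coe, h1]; simp
      obtain ⟨u, v, rfl⟩ := List.append_of_mem hbx
      have h1' := (hperm u v).1 h1
      exact ⟨u ++ v, ⟨h1', (noncrossing_insert_singleton_iff (hnot h1')).1 h2⟩,
        ⟨u, v, rfl, rfl⟩, h3⟩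
    · rintro ⟨_, ⟨h1, h2⟩, ⟨u, v, rfl, rfl⟩, h3⟩
      exact ⟨(hperm u v).2 h1, (noncrossing_insert_singleton_iff (hnot h1)).2 h2, h3⟩
  have hmem {w : List ℕ} (h : w ∈ (finite_words M).toFinset.filter Noncrossing) :
      (w : Multiset ℕ) = M := by
    simp only [Finset.mem_filter, Set.Finite.mem_toFinset, Set.mem_ofPred_eq] at h
    exact h.1
  have hlt {w : List ℕ} (h : w ∈ (finite_words M).toFinset.filter Noncrossing) :
      ∀ x ∈ w, x < b := fun x hx => hb x (by rw [← hmem h]; simpa using hx)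
  rw [hset, Set.ncard_coe_finset, Finset.card_biUnion]
  · refine Finset.sum_congr rfl fun w hw => ?_
    have hw0 : w ≠ [] := by
      rintro rfl
      exact hM (by simpa using (hmem hw).symm)
    have hbw : b ∉ w := fun h => (hlt hw b h).false
    rw [List.toFinset_card_of_nodup ((List.nodup_permutations'Aux_of_notMem w b hbw).filter _),
      ← hmem hw, Multiset.coe_card, ← count_map_descents_insert (hlt hw) hw0,
      List.count_eq_countP, List.countP_map, List.countP_eq_length_filter]
    congr 1
  · intro w hw w' hw' hne
    refine Finset.disjoint_left.2 fun x hx hx' => hne ?_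
    simp only [List.mem_toFinset, List.mem_filter, mem_permutations'Aux_iff] at hx hx'
    obtain ⟨⟨u, v, rfl, rfl⟩, -⟩ := hx
    obtain ⟨⟨u', v', rfl, he⟩, -⟩ := hx'
    have hn : b ∉ u := fun h => (hlt hw b (by simp [h])).false
    have hn' : b ∉ u' := fun h => (hlt hw' b (by simp [h])).false
    obtain ⟨rfl, rfl⟩ := append_cons_inj_first he hn hn'
    rfl

theorem ncard_linearWords_eq_card (M : Multiset ℕ) (d : ℕ) :
    (linearWords M d).ncard =
      (((finite_words M).toFinset.filter Noncrossing).filter fun w => descents w = d).card := by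
  rw [← Set.ncard_coe_finset]
  congr 1
  ext w
  simp [linearWords, and_assoc]

theorem ncard_linearWords_insert_zero {M : Multiset ℕ} {b : ℕ} (hM : M ≠ 0)
    (hb : ∀ x ∈ M, x < b) : (linearWords (b ::ₘ M) 0).ncard = (linearWords M 0).ncard := by
  rw [ncard_linearWords_insert hM hb, ncard_linearWords_eq_card, Finset.card_filter]
  refine Finset.sum_congr rfl fun w _ => ?_
  grind

theorem ncard_linearWords_insert_succ {M : Multiset ℕ} {b : ℕ} (hM : M ≠ 0)
    (hb : ∀ x ∈ M, x < b) (d : ℕ) : (linearWords (b ::ₘ M) (d + 1)).ncard =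
      (d + 2) * (linearWords M (d + 1)).ncard + (M.card - d) * (linearWords M d).ncard := by
  rw [ncard_linearWords_insert hM hb, ncard_linearWords_eq_card, ncard_linearWords_eq_card,
    Finset.card_filter, Finset.card_filter, Finset.mul_sum, Finset.mul_sum,
    ← Finset.sum_add_distrib]
  refine Finset.sum_congr rfl fun w _ => ?_
  grind

/-- Sequences that are positive exactly on `[0, n)` and log-concave. -/
structure PositiveLogConcave (n : ℕ) (u : ℕ → ℕ) : Prop where
  pos_iff : ∀ d, 0 < u d ↔ d < n
  mul_le_sq : ∀ d, u d * u (d + 2) ≤ u (d + 1) ^ 2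

theorem PositiveLogConcave.eq_zero {n : ℕ} {u : ℕ → ℕ} (h : PositiveLogConcave n u) {d : ℕ}
    (hd : n ≤ d) : u d = 0 := by
  have := h.pos_iff d
  omega

theorem PositiveLogConcave.step {n K : ℕ} {u v : ℕ → ℕ} (h : PositiveLogConcave n u)
    (hn : 1 ≤ n) (hK : n ≤ K) (hv0 : v 0 = u 0)
    (hv : ∀ d, v (d + 1) = (d + 2) * u (d + 1) + (K - d) * u d) :
    PositiveLogConcave (n + 1) v := by
  refine ⟨fun d => ?_, fun d => ?_⟩
  · rcases d with _ | d
    · rw [hv0, h.pos_iff]; omega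
    · rw [hv, Nat.add_pos_iff_pos_or_pos, Nat.mul_pos_iff_of_pos_left (by omega),
        CanonicallyOrderedAdd.mul_pos, h.pos_iff, h.pos_iff]
      omega
  · rcases d with _ | i
    · have h0 := h.mul_le_sq 0
      simp only [zero_add] at h0 ⊢
      obtain ⟨B, rfl⟩ : ∃ B, K = B + 1 := ⟨K - 1, by omega⟩
      rw [show v 2 = _ from hv 1, show v 1 = _ from hv 0, hv0]
      simp only [zero_add, Nat.add_sub_cancel, Nat.sub_zero, one_add_one_eq_two] at h0 ⊢
      nlinarith [Nat.zero_le (u 0 * u 1), Nat.zero_le (B * (u 0 * u 1)), sq_nonneg (u 1),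
        Nat.zero_le ((B + 1) ^ 2 * u 0 ^ 2)]
    · rcases le_or_gt n (i + 2) with hi | hi
      · have : v (i + 1 + 2) = 0 := by
          rw [hv, h.eq_zero hi, h.eq_zero (by omega)]; simp
        rw [this]; simp
      · obtain ⟨B, rfl⟩ : ∃ B, K = i + 2 + B := ⟨K - (i + 2), by omega⟩
        have e1 : i + 2 + B - i = B + 2 := by omega
        have e2 : i + 2 + B - (i + 1) = B + 1 := by omega
        have e3 : i + 2 + B - (i + 2) = B := by omega
        have a1 := h.mul_le_sq i
        have a2 := h.mul_le_sq (i + 1)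
        have p1 := (h.pos_iff (i + 1)).2 (by omega)
        have p2 := (h.pos_iff (i + 2)).2 hi
        rw [show v (i + 1 + 2) = _ from hv (i + 2), hv i, show v (i + 1 + 1) = _ from hv (i + 1),
          e1, e2, e3]
        simp only [add_assoc, Nat.reduceAdd] at a1 a2 p1 p2 ⊢
        generalize u i = q₀ at *
        generalize u (i + 1) = q₁ at *
        generalize u (i + 2) = q₂ at *
        generalize u (i + 3) = q₃ at *
        have a3 : q₀ * q₃ ≤ q₁ * q₂ := by
          have := Nat.mul_le_mul a1 a2
          refine le_of_mul_le_mul_left ?_ (Nat.mul_pos p1 p2)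
          nlinarith
        zify at a1 a2 a3 ⊢
        have b1 := mul_nonneg (show (0 : ℤ) ≤ (B + 1) ^ 2 - 1 by nlinarith) (sub_nonneg.2 a1)
        have b2 := mul_nonneg (show (0 : ℤ) ≤ (i + 3 : ℤ) ^ 2 - 1 by nlinarith) (sub_nonneg.2 a2)
        have b3 := mul_nonneg (show (0 : ℤ) ≤ ((i : ℤ) + 4) * (B + 2) by positivity)
          (sub_nonneg.2 a3)
        have b4 := sq_nonneg ((q₁ : ℤ) - q₂)
        linarith

theorem PositiveLogConcave.unimodal {n : ℕ} {u : ℕ → ℕ} (h : PositiveLogConcave n u) :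
    ∃ m, (∀ i j, i ≤ j → j ≤ m → u i ≤ u j) ∧ ∀ i j, m ≤ i → i ≤ j → u j ≤ u i := by
  have hex : ∃ d, u (d + 1) ≤ u d := ⟨n, by rw [h.eq_zero (Nat.le_succ n)]; exact Nat.zero_le _⟩
  refine ⟨Nat.find hex, fun i j hij hj => ?_, fun i j hi hij => ?_⟩
  · induction j, hij using Nat.le_induction with
    | base => rfl
    | succ j _ ih =>
      exact (ih (by omega)).trans (not_le.1 (Nat.find_min hex (show j < Nat.find hex by omega))).le
  · have key : ∀ d, Nat.find hex ≤ d → u (d + 1) ≤ u d := by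
      intro d hd
      induction d, hd using Nat.le_induction with
      | base => exact Nat.find_spec hex
      | succ d _ ih =>
        rcases lt_or_ge d n with hdn | hdn
        · refine le_of_mul_le_mul_left ?_ ((h.pos_iff d).2 hdn)
          nlinarith [h.mul_le_sq d]
        · rw [h.eq_zero (show n ≤ d + 1 + 1 by omega)]
          exact Nat.zero_le _
    induction j, hij using Nat.le_induction with
    | base => rfl
    | succ j hij ih => exact (key j (hi.trans hij)).trans ih

/-- The multiset in which each `i ∈ {1, …, n}` has multiplicity `k i`. -/
def content (n : ℕ) (k : ℕ → ℕ) : Multiset ℕ :=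
  ∑ i ∈ Finset.Icc 1 n, Multiset.replicate (k i) i

theorem content_succ (n : ℕ) (k : ℕ → ℕ) :
    content (n + 1) k = content n k + Multiset.replicate (k (n + 1)) (n + 1) :=
  Finset.sum_Icc_succ_top (by omega) _

theorem mem_content {n : ℕ} {k : ℕ → ℕ} {x : ℕ} :
    x ∈ content n k ↔ x ∈ Finset.Icc 1 n ∧ k x ≠ 0 := by
  rw [content, Multiset.mem_sum]
  constructor
  · rintro ⟨i, hi, hx⟩
    rw [Multiset.mem_replicate] at hx
    exact hx.2 ▸ ⟨hi, hx.1⟩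
  · rintro ⟨hx, hk⟩
    exact ⟨x, hx, Multiset.mem_replicate.2 ⟨hk, rfl⟩⟩

theorem le_card_content {n : ℕ} {k : ℕ → ℕ} (hk : ∀ i ∈ Finset.Icc 1 n, 1 ≤ k i) :
    n ≤ (content n k).card := by
  have := Finset.card_nsmul_le_sum _ _ 1 hk
  simpa [content, Multiset.card_sum] using this

theorem cons_content {n : ℕ} (hn : 1 ≤ n) (k : ℕ → ℕ) :
    n ::ₘ content n k = content n (Function.update k n (k n + 1)) := by
  obtain ⟨m, rfl⟩ : ∃ m, n = m + 1 := ⟨n - 1, by omega⟩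
  have : content m (Function.update k (m + 1) (k (m + 1) + 1)) = content m k :=
    Finset.sum_congr rfl fun i hi => by
      rw [Function.update_of_ne]
      have := (Finset.mem_Icc.1 hi).2
      omega
  rw [content_succ, content_succ, this, Function.update_self, Multiset.replicate_succ,
    Multiset.add_cons]

theorem descents_replicate (m x : ℕ) : descents (List.replicate m x) = 0 := by
  induction m with
  | zero => rfl
  | succ m ih =>
    cases m with
    | zero => rfl
    | succ m =>
      simp only [List.replicate_succ, descents] at ih ⊢
      simp [ih]

theorem positiveLogConcave_replicate (m x : ℕ) :
    PositiveLogConcave 1 fun d => (linearWords (Multiset.replicate m x) d).ncard := by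
  have hnc : Noncrossing (List.replicate m x) := fun c d hcd hs => by
    have hc := List.eq_of_mem_replicate (hs.subset (show c ∈ [c, d, c, d] by simp))
    have hd := List.eq_of_mem_replicate (hs.subset (show d ∈ [c, d, c, d] by simp))
    exact hcd (hc.trans hd.symm)
  have hw (w : List ℕ) : (w : Multiset ℕ) = Multiset.replicate m x ↔ w = List.replicate m x := by
    rw [← Multiset.coe_replicate, Multiset.coe_eq_coe, List.perm_replicate]
  have h0 : linearWords (Multiset.replicate m x) 0 = {List.replicate m x} := by
    ext w
    simp only [linearWords, hw, Set.mem_ofPred_eq, Set.mem_singleton_iff]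
    exact ⟨fun h => h.1, fun h => ⟨h, h ▸ hnc, h ▸ descents_replicate m x⟩⟩
  have h1 (d : ℕ) : linearWords (Multiset.replicate m x) (d + 1) = ∅ := by
    refine Set.eq_empty_of_forall_notMem fun w h => ?_
    have h2 := h.2.2
    rw [(hw w).1 h.1, descents_replicate] at h2
    omega
  refine ⟨fun d => ?_, fun d => by simp [h1]⟩
  cases d <;> simp [h0, h1]

theorem positiveLogConcave_linearWords {n : ℕ} (hn : 1 ≤ n) {k : ℕ → ℕ}
    (hk : ∀ i ∈ Finset.Icc 1 n, 1 ≤ k i) :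
    PositiveLogConcave n fun d => (linearWords (content n k) d).ncard := by
  induction n, hn using Nat.le_induction generalizing k with
  | base => simpa [content] using positiveLogConcave_replicate (k 1) 1
  | succ n hn ih =>
    have key (m : ℕ) : ∀ k : ℕ → ℕ, (∀ i ∈ Finset.Icc 1 n, 1 ≤ k i) →
        PositiveLogConcave (n + 1) fun d =>
          (linearWords (content n k + Multiset.replicate (m + 1) (n + 1)) d).ncard := by
      induction m with
      | zero =>
        intro k hk
        have hM : content n k ≠ 0 := fun h => by
          have := le_card_content hk
          rw [h, Multiset.card_zero] at this
          omega
        have hlt : ∀ x ∈ content n k, x < n + 1 := fun x hx => by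
          have := (Finset.mem_Icc.1 (mem_content.1 hx).1).2
          omega
        have he : content n k + Multiset.replicate (0 + 1) (n + 1) = (n + 1) ::ₘ content n k := by
          rw [zero_add, Multiset.replicate_one, add_comm, Multiset.singleton_add]
        simp only [he]
        exact (ih hk).step hn (le_card_content hk) (ncard_linearWords_insert_zero hM hlt)
          (ncard_linearWords_insert_succ hM hlt)
      | succ m ihm =>
        intro k hk
        have hn0 : k n ≠ 0 := by
          have := hk n (by simp; omega)
          omega
        have h := ihm (Function.update k n (k n + 1)) fun i hi => by
          by_cases hin : i = n
          · subst hin; simp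
          · rw [Function.update_of_ne hin]; exact hk i hi
        convert h using 2 with d
        rw [← cons_content hn, Multiset.cons_add, Multiset.replicate_succ (n + 1) (m + 1),
          Multiset.add_cons, ncard_linearWords_succ]
        · simp [mem_content, Multiset.mem_replicate]
        · simp [mem_content, hn0]; omega
        · simp
    obtain ⟨m, hm⟩ : ∃ m, k (n + 1) = m + 1 :=
      ⟨k (n + 1) - 1, by have := hk (n + 1) (by simp); omega⟩
    simp only [content_succ, hm]
    exact key m k fun i hi => hk i (by simp at hi ⊢; omega)

theorem des_eq (w : List ℕ) : des w = descents w + 1 := by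
  induction w with
  | nil => simp [des, descents]
  | cons x t ih =>
    cases t with
    | nil => simp [des, descents]
    | cons y t =>
      simp only [des, List.length_cons, Nat.add_sub_cancel, List.range_succ_eq_map,
        List.filter_cons, List.filter_map, descents] at ih ⊢
      simp only [Function.comp_def, List.getD_cons_succ, List.getD_cons_zero] at ih ⊢
      split <;> simp_all
      omega

theorem quasiStirling_iff {w : List ℕ} :
    QuasiStirling w ↔ ∀ a b, ¬ [a, b, a, b].Sublist w := by
  constructor
  · intro h a b hs
    obtain ⟨is, he, hp⟩ := List.sublist_eq_map_getElem hs
    rcases is with _ | ⟨i, _ | ⟨j, _ | ⟨k, _ | ⟨l, _ | ⟨m, is⟩⟩⟩⟩⟩ <;> simp at he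
    simp at hp
    refine h ⟨i, j, k, l, by omega, by omega, by omega, l.2, ?_, ?_⟩ <;>
      simp [← he.1, ← he.2.1, ← he.2.2.1, ← he.2.2.2]
  · rintro h ⟨i, j, k, l, hij, hjk, hkl, hl, h1, h2⟩
    rw [List.getD_eq_getElem _ _ (by omega), List.getD_eq_getElem _ _ (by omega)] at h1 h2
    have := List.map_getElem_sublist (l := w)
      (is := [⟨i, by omega⟩, ⟨j, by omega⟩, ⟨k, by omega⟩, ⟨l, hl⟩])
      (by simp; omega)
    simp [h1, h2] at this
    exact h _ _ this

theorem quasiStirling_iff_noncrossing {w : List ℕ} (h : ∀ x, w.count x ≤ 3) :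
    QuasiStirling w ↔ Noncrossing w := by
  rw [quasiStirling_iff]
  refine ⟨fun hw c d _ => hw c d, fun hw a b hs => ?_⟩
  by_cases hab : a = b
  · subst hab
    have h4 : 4 ≤ w.count a := List.replicate_sublist_iff.1 hs
    have := h a
    omega
  · exact hw a b hab hs

theorem not_quasiStirling_of_count {w : List ℕ} {x : ℕ} (h : 4 ≤ w.count x) :
    ¬ QuasiStirling w := fun hw =>
  quasiStirling_iff.1 hw x x (List.replicate_sublist_iff.2 h)

theorem qCount_eq_ncard (M : Multiset ℕ) (j : ℕ) :
    qCount M j =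
      {w : List ℕ | (w : Multiset ℕ) = M ∧ QuasiStirling w ∧ des w = j}.ncard := by
  rw [qCount, ← Set.ncard_coe_finset]
  congr 1
  ext w
  simp only [qsPerms, Finset.coe_filter, Finset.mem_filter, List.mem_toFinset,
    List.mem_permutations, Set.mem_ofPred_eq, ← Multiset.coe_eq_coe, Multiset.coe_toList, and_assoc]

theorem qCount_zero (M : Multiset ℕ) : qCount M 0 = 0 := by
  have : {w : List ℕ | (w : Multiset ℕ) = M ∧ QuasiStirling w ∧ des w = 0} = ∅ :=
    Set.eq_empty_of_forall_notMem fun w hw => by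
      have := hw.2.2
      rw [des_eq] at this
      omega
  rw [qCount_eq_ncard, this, Set.ncard_empty]

theorem qCount_succ {M : Multiset ℕ} (h : ∀ x, M.count x ≤ 3) (d : ℕ) :
    qCount M (d + 1) = (linearWords M d).ncard := by
  rw [qCount_eq_ncard]
  congr 1
  ext w
  refine and_congr_right fun hw => and_congr ?_ (by rw [des_eq]; omega)
  exact quasiStirling_iff_noncrossing fun x => by simpa [← hw] using h x

theorem qCount_eq_zero {M : Multiset ℕ} {x : ℕ} (h : 4 ≤ M.count x) (j : ℕ) : qCount M j = 0 := by
  have : {w : List ℕ | (w : Multiset ℕ) = M ∧ QuasiStirling w ∧ des w = j} = ∅ :=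
    Set.eq_empty_of_forall_notMem fun w hw =>
      not_quasiStirling_of_count (by simpa [← hw.1] using h) hw.2.1
  rw [qCount_eq_ncard, this, Set.ncard_empty]

/-- the coefficients of `Q̄_M(t)` are unimodal. -/
theorem quasiStirling_coeffs_unimodal
    (n : ℕ) (hn : 1 ≤ n) (k : ℕ → ℕ) (hk : ∀ i ∈ Finset.Icc 1 n, 1 ≤ k i)
    (K : ℕ) (hK : K = ∑ i ∈ Finset.Icc 1 n, k i)
    (M : Multiset ℕ) (hM : M = ∑ i ∈ Finset.Icc 1 n, Multiset.replicate (k i) i) :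
    ∃ j₀ : ℕ, (∀ i j : ℕ, i ≤ j → j ≤ j₀ → qCount M i ≤ qCount M j) ∧
      (∀ i j : ℕ, j₀ ≤ i → i ≤ j → j ≤ K → qCount M j ≤ qCount M i) := by
  by_cases hcount : ∀ x, M.count x ≤ 3
  · obtain ⟨m, hinc, hdec⟩ := (positiveLogConcave_linearWords hn hk).unimodal
    rw [show content n k = M from hM.symm] at hinc hdec
    refine ⟨m + 1, fun i j hij hj => ?_, fun i j hi hij _ => ?_⟩
    · rcases i with _ | i
      · rw [qCount_zero]; exact Nat.zero_le _
      · obtain ⟨j, rfl⟩ : ∃ j', j = j' + 1 := ⟨j - 1, by omega⟩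
        rw [qCount_succ hcount, qCount_succ hcount]
        exact hinc i j (by omega) (by omega)
    · obtain ⟨i, rfl⟩ : ∃ i', i = i' + 1 := ⟨i - 1, by omega⟩
      obtain ⟨j, rfl⟩ : ∃ j', j = j' + 1 := ⟨j - 1, by omega⟩
      rw [qCount_succ hcount, qCount_succ hcount]
      exact hdec i j (by omega) (by omega)
  · push Not at hcount
    obtain ⟨x, hx⟩ := hcount
    exact ⟨0, fun i j _ _ => by simp [qCount_eq_zero hx], fun i j _ _ _ => by
      simp [qCount_eq_zero hx]⟩
end

section
/- Let n ≥ 1 and M = {1^2, 2^2, …, n^2} (each of 1,…,n has multiplicity 2). Then in ℚ[[t]], Σ_{m=0}^{∞} (m^n/(n+1))·C(n+m, m)·t^m = Q̄_M(t)/(1−t)^{2n+1}, i.e. (Σ_{m=0}^{∞} (m^n/(n+1))·C(n+m, m)·t^m)·(1−t)^{2n+1} = Q̄_M(t). -/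
open scoped Classical

section Words

open scoped List

theorem des_cons_cons (x y : ℕ) (l : List ℕ) :
    des (x :: y :: l) = des (y :: l) + if y < x then 1 else 0 := by
  simp only [des, List.length_cons, Nat.add_sub_cancel]
  rw [List.range_succ_eq_map, List.filter_cons, List.filter_map]
  by_cases h : y < x <;> simp [h, Function.comp_def]

theorem quasiStirling_iff_sublist (w : List ℕ) :
    QuasiStirling w ↔ ∀ x y, ¬ [x, y, x, y] <+ w := by
  rw [QuasiStirling, ← not_iff_not, not_not]
  push Not
  constructor
  · rintro ⟨i, j, k, l, hij, hjk, hkl, hl, h1, h2⟩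
    refine ⟨w.getD i 0, w.getD j 0, ?_⟩
    have := List.map_getElem_sublist (l := w)
      (is := [⟨i, by omega⟩, ⟨j, by omega⟩, ⟨k, by omega⟩, ⟨l, by omega⟩])
      (by simp; omega)
    rw [List.getD_eq_getElem _ _ (by omega), List.getD_eq_getElem _ _ (by omega)] at h1 h2 ⊢
    simpa [← h1, ← h2] using this
  · rintro ⟨x, y, h⟩
    obtain ⟨is, h1, h2⟩ := List.sublist_eq_map_getElem h
    obtain ⟨i, j, k, l, rfl⟩ : ∃ i j k l, is = [i, j, k, l] :=
      List.length_eq_four.1 (by simpa using (congrArg List.length h1).symm)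
    simp only [List.map_cons, List.map_nil, List.cons.injEq, and_true] at h1
    simp only [List.pairwise_cons, List.mem_cons, forall_eq_or_imp] at h2
    refine ⟨i, j, k, l, h2.1.1, h2.2.1.1, h2.2.2.1.1, l.2, ?_, ?_⟩ <;>
    rw [List.getD_eq_getElem _ _ (by omega), List.getD_eq_getElem _ _ (by omega)]
    · exact h1.1.symm.trans h1.2.2.1
    · exact h1.2.1.symm.trans h1.2.2.2

theorem cons_sublist_of_append {α : Type*} {u : α} {l A X : List α} (hu : u ∉ A)
    (h : u :: l <+ A ++ X) : u :: l <+ X := by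
  obtain ⟨l₁, l₂, h1, h2, h3⟩ := List.sublist_append_iff.1 h
  cases l₁ with
  | nil => simpa [h1] using h3
  | cons a l₁ =>
    simp only [List.cons_append, List.cons.injEq] at h1
    exact absurd (h2.subset (by simp [h1.1])) hu

theorem not_sandwich_sublist {α : Type*} {u z : α} {A M C : List α} (hA : u ∉ A) (hC : u ∉ C)
    (hz : z ∉ M) : ¬ [u, z, u] <+ A ++ (M ++ C) := by
  intro h
  have h2 := (cons_sublist_of_append hA h).reverse
  rw [List.reverse_append] at h2
  have h3 := cons_sublist_of_append (l := [z, u]) (by simpa using hC) h2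
  exact hz (List.mem_reverse.1 (h3.subset (by simp)))

theorem QuasiStirling.sublist {w w' : List ℕ} (h : QuasiStirling w) (h' : w' <+ w) :
    QuasiStirling w' := by
  rw [quasiStirling_iff_sublist] at *
  exact fun x y hxy => h x y (hxy.trans h')

theorem QuasiStirling.insert_middle {A M C : List ℕ} (hM : QuasiStirling M)
    (hAC : QuasiStirling (A ++ C)) (hd : ∀ u ∈ M, u ∉ A ∧ u ∉ C) :
    QuasiStirling (A ++ (M ++ C)) := by
  rw [quasiStirling_iff_sublist] at *
  have hM' : M.filter (· ∈ M) = M := by simp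
  have hM'' : M.filter (· ∉ M) = [] := by simp
  have hA : A.filter (· ∈ M) = [] := by
    simp only [List.filter_eq_nil_iff, decide_eq_true_eq]; exact fun u hu h => (hd u h).1 hu
  have hC : C.filter (· ∈ M) = [] := by
    simp only [List.filter_eq_nil_iff, decide_eq_true_eq]; exact fun u hu h => (hd u h).2 hu
  have hA' : A.filter (· ∉ M) = A := by
    simp only [List.filter_eq_self, decide_eq_true_eq]; exact fun u hu h => (hd u h).1 hu
  have hC' : C.filter (· ∉ M) = C := by
    simp only [List.filter_eq_self, decide_eq_true_eq]; exact fun u hu h => (hd u h).2 hu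
  intro x y h
  by_cases hx : x ∈ M <;> by_cases hy : y ∈ M
  · have := h.filter (· ∈ M)
    rw [List.filter_append, List.filter_append, hA, hM', hC] at this
    exact hM x y (by simpa [List.filter_cons, hx, hy] using this)
  · exact not_sandwich_sublist (hd x hx).1 (hd x hx).2 hy
      (List.Sublist.trans (by simp) h)
  · exact not_sandwich_sublist (hd y hy).1 (hd y hy).2 hx
      (List.Sublist.trans (by simp) h)
  · have := h.filter (· ∉ M)
    rw [List.filter_append, List.filter_append, hA', hM'', hC'] at this
    exact hAC x y (by simpa [List.filter_cons, hx, hy] using this)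

theorem QuasiStirling.surround {v : ℕ} {B : List ℕ} (hB : QuasiStirling B) (hv : v ∉ B) :
    QuasiStirling (v :: (B ++ [v])) := by
  have hvv : QuasiStirling [v, v] := by
    rw [quasiStirling_iff_sublist]
    intro x y h
    simpa using h.length_le
  exact hB.insert_middle (A := [v]) (C := [v]) hvv (by
    intro u hu
    have : u ≠ v := fun h => hv (h ▸ hu)
    simp [this])

/-- The multiset in which every element of `S` has multiplicity two. -/
def doubled (S : Finset ℕ) : Multiset ℕ := ∑ i ∈ S, Multiset.replicate 2 i

theorem count_doubled (S : Finset ℕ) (u : ℕ) :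
    (doubled S).count u = if u ∈ S then 2 else 0 := by
  simp [doubled, Multiset.count_sum', Multiset.count_replicate, -Multiset.replicate_succ]

theorem mem_qsPerms_doubled {S : Finset ℕ} {w : List ℕ} :
    w ∈ qsPerms (doubled S) ↔ (∀ u, w.count u = if u ∈ S then 2 else 0) ∧ QuasiStirling w := by
  have : w ∈ qsPerms (doubled S) ↔ (w : Multiset ℕ) = doubled S ∧ QuasiStirling w := by
    rw [qsPerms, Finset.mem_filter, List.mem_toFinset, List.mem_permutations,
      ← Multiset.coe_eq_coe, Multiset.coe_toList]
  rw [this, Multiset.ext]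
  simp only [Multiset.coe_count, count_doubled]

theorem length_of_mem_qsPerms {S : Finset ℕ} {w : List ℕ} (hw : w ∈ qsPerms (doubled S)) :
    w.length = 2 * S.card := by
  rw [qsPerms, Finset.mem_filter, List.mem_toFinset, List.mem_permutations] at hw
  rw [hw.1.length_eq, Multiset.length_toList, doubled]
  simp [mul_comm]

theorem mem_iff_of_mem_qsPerms {S : Finset ℕ} {w : List ℕ} (hw : w ∈ qsPerms (doubled S)) (u : ℕ) :
    u ∈ w ↔ u ∈ S := by
  rw [← List.count_pos_iff, (mem_qsPerms_doubled.1 hw).1]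
  split_ifs with h <;> simp [h]

/-- The number of descents of a word followed by a letter smaller than all of its letters. -/
def closedDes (w : List ℕ) : ℕ := if w = [] then 0 else des w

@[simp] theorem closedDes_nil : closedDes [] = 0 := rfl

@[simp] theorem closedDes_singleton (x : ℕ) : closedDes [x] = 1 := rfl

theorem closedDes_cons_cons (x y : ℕ) (l : List ℕ) :
    closedDes (x :: y :: l) = closedDes (y :: l) + if y < x then 1 else 0 := by
  simp [closedDes, des_cons_cons]

theorem closedDes_append_cons {v : ℕ} {A X : List ℕ} (hA : ∀ u ∈ A, v < u) :
    closedDes (A ++ v :: X) = closedDes A + closedDes (v :: X) := by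
  induction A with
  | nil => simp
  | cons x A ih =>
    cases A with
    | nil => simp [closedDes_cons_cons, hA x (by simp), add_comm]
    | cons y A =>
      have := ih (fun u hu => hA u (by simp [hu]))
      simp only [List.cons_append, closedDes_cons_cons] at this ⊢
      omega

theorem closedDes_cons_of_lt {v : ℕ} {X : List ℕ} (hX : ∀ u ∈ X, v < u) :
    closedDes (v :: X) = if X = [] then 1 else closedDes X := by
  cases X with
  | nil => simp
  | cons x X => simp [closedDes_cons_cons, (hX x (by simp)).le]

theorem closedDes_insert {v : ℕ} {A B C : List ℕ} (hA : ∀ u ∈ A, v < u) (hB : ∀ u ∈ B, v < u) :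
    closedDes (A ++ v :: (B ++ v :: C)) = closedDes B + closedDes (A ++ v :: C) := by
  rw [closedDes_append_cons hA, closedDes_append_cons hA]
  cases B with
  | nil => simp [closedDes_cons_cons]
  | cons x B =>
    rw [List.cons_append, closedDes_cons_cons, ← List.cons_append, closedDes_append_cons hB,
      if_neg (hB x (by simp)).not_gt]
    omega

open Polynomial in
theorem sum_pow_closedDes_insert {v : ℕ} (W : List ℕ) (hW : ∀ u ∈ W, v < u) :
    ∑ p ∈ Finset.range (W.length + 1), (X : ℚ[X]) ^ closedDes (W.take p ++ v :: W.drop p) =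
      X * (1 - X) * derivative (X ^ closedDes W) + (W.length + 1 : ℚ[X]) * (X * X ^ closedDes W) := by
  induction W with
  | nil => simp
  | cons x W ih =>
    cases W with
    | nil =>
      have := hW x (by simp)
      simp [Finset.sum_range_succ, closedDes_cons_cons, this, this.le.not_gt]
      ring
    | cons y W =>
      have h1 := ih (fun u hu => hW u (by simp [hu]))
      have hx : v < x := hW x (by simp)
      have hy : v < y := hW y (by simp)
      rw [Finset.sum_range_succ'] at h1 ⊢
      rw [List.length_cons (a := x), Finset.sum_range_succ']
      simp only [List.length_cons, List.take_succ_cons, List.drop_succ_cons, List.take_zero,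
        List.drop_zero, List.nil_append, List.cons_append, closedDes_cons_cons, hx,
        hx.le.not_gt, hy.le.not_gt, if_true, if_false, pow_add, ← Finset.sum_mul,
        derivative_mul, add_zero, pow_one] at h1 ⊢
      rw [← eq_sub_iff_add_eq] at h1
      rw [h1]
      split_ifs <;> simp <;> ring

theorem append_cons_append_cons_inj {α : Type*} {v : α} {A B C A' B' C' : List α}
    (hA : v ∉ A) (hB : v ∉ B) (hA' : v ∉ A') (hB' : v ∉ B')
    (h : A ++ v :: (B ++ v :: C) = A' ++ v :: (B' ++ v :: C')) : A = A' ∧ B = B' ∧ C = C' := by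
  have key : ∀ {A A' X X' : List α}, v ∉ A → v ∉ A' → A ++ v :: X = A' ++ v :: X' →
      A = A' ∧ X = X' := by
    intro A
    induction A with
    | nil =>
      intro A' X X' _ h' h
      cases A' with
      | nil => simpa using h
      | cons a A' => simp at h h'; exact absurd h.1 h'.1
    | cons a A ih =>
      intro A' X X' h'' h' h
      cases A' with
      | nil => simp at h h''; exact absurd h.1.symm h''.1
      | cons b A' =>
        simp only [List.cons_append, List.cons.injEq, List.mem_cons, not_or] at h h' h'' ⊢
        exact ⟨⟨h.1, (ih h''.2 h'.2 h.2).1⟩, (ih h''.2 h'.2 h.2).2⟩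
  obtain ⟨h1, h2⟩ := key hA hA' h
  exact ⟨h1, key hB hB' h2⟩

theorem insert_mem_qsPerms {v : ℕ} {S T : Finset ℕ} (hv : v ∉ S) (hT : T ⊆ S) {A B C : List ℕ}
    (hB : B ∈ qsPerms (doubled T)) (hAC : A ++ C ∈ qsPerms (doubled (S \ T))) :
    A ++ v :: (B ++ v :: C) ∈ qsPerms (doubled (insert v S)) := by
  have hvT : v ∉ T := fun h => hv (hT h)
  have hBm := mem_iff_of_mem_qsPerms hB
  have hACm := mem_iff_of_mem_qsPerms hAC
  rw [mem_qsPerms_doubled] at *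
  constructor
  · intro u
    have h1 := hB.1 u
    have h2 := hAC.1 u
    rw [List.count_append] at h2
    simp only [List.count_append, List.count_cons, Finset.mem_insert, beq_iff_eq]
    by_cases huv : u = v
    · subst huv
      simp [hvT, hv] at h1 h2 ⊢
      omega
    · have : v ≠ u := Ne.symm huv
      by_cases huT : u ∈ T
      · simp [huT, huv, this] at h1 h2 ⊢
        simp [h1, h2, hT huT]
      · simp [huT] at h1
        simp [huT] at h2
        simp [huv, this, h1, h2]
  · have := QuasiStirling.insert_middle (A := A) (C := C)
      (hB.2.surround fun h => hvT ((hBm v).1 h)) hAC.2 (by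
        intro u hu
        rw [← not_or, ← List.mem_append, hACm]
        simp only [List.mem_cons, List.mem_append, List.not_mem_nil, or_false, hBm] at hu
        rintro h
        rw [Finset.mem_sdiff] at h
        rcases hu with rfl | hu | rfl
        · exact hv h.1
        · exact h.2 hu
        · exact hv h.1)
    simpa using this

theorem exists_insert_of_mem_qsPerms {v : ℕ} {S : Finset ℕ} (hv : v ∉ S) {w : List ℕ}
    (hw : w ∈ qsPerms (doubled (insert v S))) :
    ∃ T ⊆ S, ∃ A B C : List ℕ, B ∈ qsPerms (doubled T) ∧ A ++ C ∈ qsPerms (doubled (S \ T)) ∧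
      A ++ v :: (B ++ v :: C) = w := by
  rw [mem_qsPerms_doubled] at hw
  obtain ⟨hc, hq⟩ := hw
  have hcv : w.count v = 2 := by simp [hc]
  obtain ⟨A, X, rfl, hvA⟩ :=
    List.eq_append_cons_of_mem (List.count_pos_iff.1 (by omega : 0 < w.count v))
  have hcX : X.count v = 1 := by
    simpa [List.count_eq_zero_of_not_mem hvA] using hcv
  obtain ⟨B, C, rfl, hvB⟩ :=
    List.eq_append_cons_of_mem (List.count_pos_iff.1 (by omega : 0 < X.count v))
  have hvC : v ∉ C := by
    rw [← List.count_eq_zero]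
    simpa [List.count_eq_zero_of_not_mem hvB] using hcX
  have hq' := (quasiStirling_iff_sublist _).1 hq
  have hBA : ∀ u ∈ B, u ∉ A := fun u hB hA => hq' u v <|
    (List.singleton_sublist.2 hA).append <| List.Sublist.cons_cons v <|
      (List.singleton_sublist.2 hB).append <| List.Sublist.cons_cons v <| List.nil_sublist C
  have hBC : ∀ u ∈ B, u ∉ C := fun u hB hC => hq' v u <|
    (List.nil_sublist A).append <| List.Sublist.cons_cons v <|
      (List.singleton_sublist.2 hB).append <| List.Sublist.cons_cons v <|
        List.singleton_sublist.2 hC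
  have hcount : ∀ u, u ≠ v →
      A.count u + (B.count u + C.count u) = if u ∈ S then 2 else 0 := by
    intro u huv
    simpa [List.count_cons, huv, huv.symm] using hc u
  have hBS : ∀ u ∈ B, u ∈ S := by
    intro u hu
    have huv : u ≠ v := fun h => hvB (h ▸ hu)
    by_contra huS
    have := hcount u huv
    rw [if_neg huS] at this
    have := List.count_pos_iff.2 hu
    omega
  refine ⟨B.toFinset, fun u hu => hBS u (List.mem_toFinset.1 hu), A, B, C, ?_, ?_, rfl⟩
  · rw [mem_qsPerms_doubled]
    refine ⟨fun u => ?_, hq.sublist ?_⟩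
    · by_cases hu : u ∈ B
      · have := hcount u (fun h => hvB (h ▸ hu))
        rw [List.count_eq_zero_of_not_mem (hBA u hu), List.count_eq_zero_of_not_mem (hBC u hu),
          if_pos (hBS u hu)] at this
        simp [hu]
        omega
      · simp [hu, List.count_eq_zero_of_not_mem hu]
    · exact (List.sublist_append_left B _).trans
        ((List.sublist_cons_self v _).trans (List.sublist_append_right A _))
  · rw [mem_qsPerms_doubled]
    refine ⟨fun u => ?_, hq.sublist ?_⟩
    · rw [List.count_append]
      by_cases huv : u = v
      · subst huv
        simp [hv, List.count_eq_zero_of_not_mem hvA, List.count_eq_zero_of_not_mem hvC]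
      · by_cases hu : u ∈ B
        · simp [hu, List.count_eq_zero_of_not_mem (hBA u hu),
            List.count_eq_zero_of_not_mem (hBC u hu)]
        · have := hcount u huv
          rw [List.count_eq_zero_of_not_mem hu, zero_add] at this
          simp [this, hu]
    · exact (List.Sublist.refl A).append <| ((List.sublist_cons_self v C).trans
        (List.sublist_append_right B _)).trans (List.sublist_cons_self v _)

theorem sum_qsPerms_insert {R : Type*} [AddCommMonoid R] {v : ℕ} {S : Finset ℕ} (hv : v ∉ S)
    (f : List ℕ → R) :
    ∑ w ∈ qsPerms (doubled (insert v S)), f w =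
      ∑ T ∈ S.powerset, ∑ B ∈ qsPerms (doubled T), ∑ W ∈ qsPerms (doubled (S \ T)),
        ∑ p ∈ Finset.range (W.length + 1), f (W.take p ++ v :: (B ++ v :: W.drop p)) := by
  symm
  simp only [Finset.sum_sigma']
  refine Finset.sum_nbij (fun x : (_ : Finset ℕ) × (_ : List ℕ) × (_ : List ℕ) × ℕ =>
      x.2.2.1.take x.2.2.2 ++ v :: (x.2.1 ++ v :: x.2.2.1.drop x.2.2.2))
    ?_ ?_ ?_ fun _ _ => rfl
  · rintro ⟨T, B, W, p⟩ h
    simp only [Finset.mem_sigma, Finset.mem_powerset, Finset.mem_range] at h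
    exact insert_mem_qsPerms hv h.1 h.2.1 (by simpa using h.2.2.1)
  · rintro ⟨T, B, W, p⟩ h ⟨T', B', W', p'⟩ h' heq
    simp only [Finset.mem_coe, Finset.mem_sigma, Finset.mem_powerset, Finset.mem_range] at h h'
    have hW : ∀ {T : Finset ℕ} {W : List ℕ}, W ∈ qsPerms (doubled (S \ T)) → v ∉ W := by
      intro T W h
      simp [mem_iff_of_mem_qsPerms h, hv]
    obtain ⟨h1, h2, h3⟩ := append_cons_append_cons_inj
      (fun hm => hW h.2.2.1 (List.mem_of_mem_take hm))
      (fun hm => hv (h.1 ((mem_iff_of_mem_qsPerms h.2.1 v).1 hm)))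
      (fun hm => hW h'.2.2.1 (List.mem_of_mem_take hm))
      (fun hm => hv (h'.1 ((mem_iff_of_mem_qsPerms h'.2.1 v).1 hm))) heq
    dsimp only at h1 h2 h3
    have hWW : W = W' := by rw [← List.take_append_drop p W, h1, h3, List.take_append_drop]
    have hTT : T = T' := by
      ext u
      rw [← mem_iff_of_mem_qsPerms h.2.1, ← mem_iff_of_mem_qsPerms h'.2.1, h2]
    have hpp : p = p' := by
      have := congrArg List.length h1
      rw [List.length_take, List.length_take, ← hWW] at this
      have hp := h.2.2.2
      have hp' := h'.2.2.2
      rw [← hWW] at hp'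
      omega
    subst hWW hTT hpp h2
    rfl
  · intro w hw
    obtain ⟨T, hT, A, B, C, hB, hAC, rfl⟩ := exists_insert_of_mem_qsPerms hv hw
    exact ⟨⟨T, B, A ++ C, A.length⟩, by simp [hT, hB, hAC], by simp⟩

open Polynomial in
/-- The descent polynomial of the quasi-Stirling words using every letter of `S` twice. -/
noncomputable def descentPoly (S : Finset ℕ) : ℚ[X] :=
  ∑ w ∈ qsPerms (doubled S), X ^ closedDes w

theorem descentPoly_empty : descentPoly ∅ = 1 := by
  have : qsPerms (doubled ∅) = {[]} := by
    ext w
    rw [mem_qsPerms_doubled, Finset.mem_singleton]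
    constructor
    · rintro ⟨h, -⟩
      exact List.eq_nil_iff_forall_not_mem.2 fun u => List.count_eq_zero.1 (h u)
    · rintro rfl
      exact ⟨by simp, by simp [quasiStirling_iff_sublist]⟩
  simp [descentPoly, this]

theorem qsPoly_doubled {S : Finset ℕ} (hS : S.Nonempty) : qsPoly (doubled S) = descentPoly S := by
  refine Finset.sum_congr rfl fun w hw => ?_
  rw [closedDes, if_neg]
  rintro rfl
  obtain ⟨u, hu⟩ := hS
  simpa using (mem_iff_of_mem_qsPerms hw u).2 hu

open Polynomial in
theorem descentPoly_insert {v : ℕ} {S : Finset ℕ} (hv : ∀ u ∈ S, v < u) :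
    descentPoly (insert v S) = ∑ T ∈ S.powerset, descentPoly T *
      (X * (1 - X) * derivative (descentPoly (S \ T)) +
        (2 * (S \ T).card + 1 : ℚ[X]) * (X * descentPoly (S \ T))) := by
  rw [descentPoly, sum_qsPerms_insert fun h => (hv v h).ne rfl]
  refine Finset.sum_congr rfl fun T hT => ?_
  rw [Finset.mem_powerset] at hT
  simp only [descentPoly, map_sum, Finset.mul_sum, ← Finset.sum_add_distrib, Finset.sum_mul]
  refine (Finset.sum_comm.trans ?_).symm
  refine Finset.sum_congr rfl fun B hB => Finset.sum_congr rfl fun W hW => ?_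
  have hB' : ∀ u ∈ B, v < u := fun u hu => hv u (hT ((mem_iff_of_mem_qsPerms hB u).1 hu))
  have hW' : ∀ u ∈ W, v < u := fun u hu =>
    hv u (Finset.sdiff_subset ((mem_iff_of_mem_qsPerms hW u).1 hu))
  have hlen : (W.length : ℚ[X]) = 2 * (S \ T).card := by
    rw [length_of_mem_qsPerms hW]; push_cast; rfl
  rw [← hlen, ← sum_pow_closedDes_insert W hW', Finset.mul_sum]
  refine Finset.sum_congr rfl fun p _ => ?_
  rw [closedDes_insert (fun u hu => hW' u (List.mem_of_mem_take hu)) hB', pow_add]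

end Words

section Burgers

open PowerSeries

/-- If `d G = G * D G` for commuting derivations `d` and `D`, then `(n + 1) * d^n G = D^n G^(n+1)`. -/
theorem Derivation.iterate_of_burgers {A : Type*} [CommRing A] [Algebra ℚ A]
    (d D : Derivation ℚ A A) (hcomm : ∀ a, d (D a) = D (d a)) {G : A} (hG : d G = G * D G)
    (n : ℕ) : ((n : ℚ) + 1) • d^[n] G = D^[n] (G ^ (n + 1)) := by
  induction n with
  | zero => simp
  | succ n ih =>
    have hn : ((n : ℚ) + 1) ≠ 0 := by positivity
    have h1 : d (G ^ (n + 1)) * ((n : A) + 2) = ((n : A) + 1) * D (G ^ (n + 1 + 1)) := by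
      rw [Derivation.leibniz_pow, Derivation.leibniz_pow, hG]
      simp only [Nat.add_sub_cancel, smul_eq_mul, nsmul_eq_mul]
      push_cast
      ring
    have h2 : ((n : ℚ) + 2) • d (G ^ (n + 1)) = ((n : ℚ) + 1) • D (G ^ (n + 1 + 1)) := by
      simp only [Algebra.smul_def, map_add, map_one, map_ofNat]
      rw [_root_.map_natCast (algebraMap ℚ A), ← h1, mul_comm]
    have h3 : ((n : ℚ) + 1) • d^[n + 1] G = D^[n] (d (G ^ (n + 1))) := by
      have hc : Function.Commute d D := hcomm
      rw [Function.iterate_succ_apply', ← map_smul, ih]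
      exact hc.iterate_right n _
    have h4 : ∀ (c : ℚ) (a : A), D^[n] (c • a) = c • D^[n] a := by
      intro c a
      have hc : Function.Commute D (c • ·) := D.map_smul c
      exact hc.iterate_left n a
    have h5 := congrArg D^[n] h2
    rw [h4, h4, ← h3, smul_smul, mul_comm, ← smul_smul] at h5
    have h6 := smul_right_injective A hn h5
    rw [Function.iterate_succ_apply D, ← h6]
    push_cast
    congr 1
    ring

/-- The coefficientwise extension of a derivation to power series. -/
noncomputable def PowerSeries.mapDerivation {R A : Type*} [CommRing R] [CommRing A] [Algebra R A]
    (D : Derivation R A A) : Derivation R A⟦X⟧ A⟦X⟧ :=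
  Derivation.mk'
    { toFun := fun f => PowerSeries.mk fun n => D (coeff n f)
      map_add' := fun f g => by ext; simp
      map_smul' := fun c f => by ext; simp }
    (fun f g => by
      ext n
      simp only [LinearMap.coe_mk, AddHom.coe_mk, coeff_mk, coeff_mul, map_sum, Derivation.leibniz,
        smul_eq_mul, map_add, Finset.sum_add_distrib]
      congr 1
      exact (Finset.Nat.sum_antidiagonal_swap
        (f := fun x : ℕ × ℕ => coeff x.1 g * D (coeff x.2 f))))

theorem PowerSeries.coeff_mapDerivation {R A : Type*} [CommRing R] [CommRing A] [Algebra R A]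
    (D : Derivation R A A) (f : A⟦X⟧) (n : ℕ) :
    coeff n (mapDerivation D f) = D (coeff n f) := by
  simp [mapDerivation]

theorem PowerSeries.coeff_iterate_mapDerivation {R A : Type*} [CommRing R] [CommRing A]
    [Algebra R A] (D : Derivation R A A) (f : A⟦X⟧) (n k : ℕ) :
    coeff n ((mapDerivation D)^[k] f) = D^[k] (coeff n f) := by
  induction k with
  | zero => rfl
  | succ k ih => rw [Function.iterate_succ_apply', coeff_mapDerivation, ih,
      Function.iterate_succ_apply']

theorem PowerSeries.factorial_mul_coeff_iterate_derivative {A : Type*} [CommRing A]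
    (f : A⟦X⟧) (k n : ℕ) :
    (n.factorial : A) * coeff n ((derivative A)^[k] f) =
      (n + k).factorial * coeff (n + k) f := by
  induction k generalizing n with
  | zero => rfl
  | succ k ih =>
    rw [Function.iterate_succ_apply', coeff_derivative, mul_comm (coeff _ _), ← mul_assoc]
    have := ih (n + 1)
    rw [Nat.factorial_succ] at this
    push_cast at this
    rw [mul_comm (n.factorial : A), this, show n + 1 + k = n + (k + 1) by ring]

/-- Solution of the convolution recurrence `P (n + 1) = ∑ C(n, j) * P j * D (P (n - j))`. -/
theorem solve_convolution_recurrence {A : Type*} [CommRing A] [Algebra ℚ A] (D : Derivation ℚ A A)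
    (P : ℕ → A) (hP : ∀ n, P (n + 1) =
      ∑ j ∈ Finset.range (n + 1), n.choose j • (P j * D (P (n - j)))) (n : ℕ) :
    ((n : ℚ) + 1) • P n = D^[n] (P 0 ^ (n + 1)) := by
  let G : A⟦X⟧ := PowerSeries.mk fun n => ((n.factorial : ℚ)⁻¹) • P n
  have hcomm : ∀ a, (derivative A).restrictScalars ℚ (mapDerivation D a) =
      mapDerivation D ((derivative A).restrictScalars ℚ a) := by
    intro a
    ext n
    simp only [Derivation.restrictScalars_apply, coeff_derivative, coeff_mapDerivation,
      Derivation.leibniz, map_add, Derivation.map_natCast, Derivation.map_one_eq_zero, smul_eq_mul]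
    ring
  have hG : (derivative A).restrictScalars ℚ G = G * mapDerivation D G := by
    ext n
    rw [Derivation.restrictScalars_apply, coeff_derivative, coeff_mul,
      Finset.Nat.sum_antidiagonal_eq_sum_range_succ_mk]
    simp only [coeff_mapDerivation, G, coeff_mk, hP, Nat.succ_eq_add_one]
    rw [Finset.smul_sum, Finset.sum_mul]
    refine Finset.sum_congr rfl fun j hj => ?_
    have hj' : j ≤ n := by simpa [Nat.lt_succ_iff] using hj
    have h : (((n + 1).factorial : ℚ)⁻¹ * (n.choose j : ℚ)) * ((n : ℚ) + 1) =
        (j.factorial : ℚ)⁻¹ * ((n - j).factorial : ℚ)⁻¹ := by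
      rw [Nat.cast_choose ℚ hj', Nat.factorial_succ]
      push_cast
      have : ((n : ℚ) + 1) ≠ 0 := by positivity
      field_simp
    rw [D.map_smul, smul_mul_smul_comm, ← h, ← Nat.cast_smul_eq_nsmul ℚ, smul_smul,
      mul_comm _ ((n : ℚ) + 1), ← smul_smul]
    simp only [Algebra.smul_def, map_add, map_natCast, map_one, map_mul]
    ring
  have key := congrArg (coeff 0) (Derivation.iterate_of_burgers _ _ hcomm hG n)
  have h0 := factorial_mul_coeff_iterate_derivative G n 0
  have hf : (n.factorial : ℚ) ≠ 0 := by positivity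
  have hcoe : ⇑((derivative A).restrictScalars ℚ) = ⇑(derivative A) := rfl
  rw [coeff_iterate_mapDerivation] at key
  simp only [hcoe, coeff_smul] at key
  simp only [zero_add, Nat.factorial_zero, Nat.cast_one, one_mul, G, coeff_mk] at h0
  have h1 : (n.factorial : A) = algebraMap ℚ A n.factorial :=
    (map_natCast (algebraMap ℚ A) _).symm
  rw [h1, ← Algebra.smul_def, smul_smul, mul_inv_cancel₀ hf, one_smul] at h0
  rw [← h0, key]
  simp [G]

end Burgers

open PowerSeries in
/-- The descent series `descentPoly S / (1 - t) ^ (2 * |S| + 1)` of an `n`-element set `S`, defined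
by its recurrence in `n`. -/
noncomputable def descentSeries : ℕ → ℚ⟦X⟧
  | 0 => PowerSeries.mk 1
  | n + 1 => ∑ j : Fin (n + 1), n.choose j •
      (descentSeries j * (X * derivative ℚ (descentSeries (n - j))))

open PowerSeries in
theorem descentSeries_succ (n : ℕ) : descentSeries (n + 1) =
    ∑ j ∈ Finset.range (n + 1), n.choose j •
      (descentSeries j * (X * derivative ℚ (descentSeries (n - j)))) := by
  rw [descentSeries, Finset.sum_range]

open PowerSeries in
theorem descentSeries_eq (n : ℕ) : descentSeries n =
    PowerSeries.mk fun m => (m : ℚ) ^ n / ((n + 1 : ℕ) : ℚ) * ((n + m).choose m : ℚ) := by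
  have key := solve_convolution_recurrence ((X : ℚ⟦X⟧) • derivative ℚ) descentSeries
    (by simpa using descentSeries_succ) n
  have hD : ∀ (k m : ℕ) (f : ℚ⟦X⟧), coeff m ((⇑((X : ℚ⟦X⟧) • derivative ℚ))^[k] f) =
      (m : ℚ) ^ k * coeff m f := by
    intro k m f
    induction k with
    | zero => simp
    | succ k ih =>
      rw [Function.iterate_succ_apply', Derivation.smul_apply, smul_eq_mul, pow_succ,
        mul_comm ((m : ℚ) ^ k), mul_assoc, ← ih]
      cases m with
      | zero => simp
      | succ m => rw [coeff_succ_X_mul, coeff_derivative]; push_cast; ring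
  ext m
  have h := congrArg (coeff m) key
  rw [hD, descentSeries, mk_one_pow_eq_mk_choose_add, coeff_smul, coeff_mk, smul_eq_mul] at h
  have hn : ((n : ℚ) + 1) ≠ 0 := by positivity
  rw [coeff_mk, ← Nat.choose_symm_add, div_mul_eq_mul_div]
  push_cast
  rw [eq_div_iff hn, ← h, mul_comm]

open PowerSeries in
theorem coe_descentPoly (S : Finset ℕ) :
    (descentPoly S : ℚ⟦X⟧) = descentSeries S.card * (1 - X) ^ (2 * S.card + 1) := by
  induction hn : S.card using Nat.strong_induction_on generalizing S with
  | _ n ih =>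
    obtain rfl | hS := S.eq_empty_or_nonempty
    · obtain rfl : n = 0 := by simpa using hn.symm
      simp [descentPoly_empty, descentSeries, mk_one_mul_one_sub_eq_one]
    obtain ⟨v, S, hv, rfl⟩ : ∃ v S', (∀ u ∈ S', v < u) ∧ insert v S' = S :=
      ⟨S.min' hS, S.erase (S.min' hS), fun u hu => S.min'_lt_of_mem_erase_min' hS hu,
        Finset.insert_erase (S.min'_mem hS)⟩
    rw [Finset.card_insert_of_notMem fun h => (hv v h).ne rfl] at hn
    subst hn
    rw [descentPoly_insert hv, descentSeries_succ, ← Finset.sum_powerset_apply_card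
      (fun j => descentSeries j * (X * derivative ℚ (descentSeries (S.card - j)))), Finset.sum_mul,
      ← Polynomial.coeToPowerSeries.ringHom_apply, map_sum]
    refine Finset.sum_congr rfl fun T hT => ?_
    rw [Finset.mem_powerset] at hT
    have hcard := Finset.card_sdiff_add_card_eq_card hT
    have h1 := ih T.card (by omega) T rfl
    have h2 := ih (S \ T).card (by omega) (S \ T) rfl
    rw [show S.card - T.card = (S \ T).card by omega, ← hcard]
    generalize (S \ T).card = k at h2 ⊢
    generalize T.card = j at h1 ⊢
    have h3 := congrArg (derivative ℚ) h2
    rw [derivative_coe, Derivation.leibniz, Derivation.leibniz_pow] at h3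
    simp only [Polynomial.coeToPowerSeries.ringHom_apply, Polynomial.coe_mul, Polynomial.coe_add,
      Polynomial.coe_sub, Polynomial.coe_X, Polynomial.coe_one, h1, h2, h3]
    have h4 : ((2 : Polynomial ℚ) : ℚ⟦X⟧) = 2 := map_ofNat Polynomial.coeToPowerSeries.ringHom 2
    have h5 : ((k : Polynomial ℚ) : ℚ⟦X⟧) = k := map_natCast Polynomial.coeToPowerSeries.ringHom k
    rw [h4, h5]
    simp only [map_sub, smul_eq_mul, nsmul_eq_mul, Nat.add_sub_cancel]
    rw [show derivative ℚ (X : ℚ⟦X⟧) = 1 from derivative_X, Derivation.map_one_eq_zero]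
    push_cast
    ring

/-- Elizalde's identity for `M = {1², 2², …, n²}`. -/
theorem quasiStirling_powerSeries_identity_squares
    (n : ℕ) (hn : 1 ≤ n)
    (M : Multiset ℕ) (hM : M = ∑ i ∈ Finset.Icc 1 n, Multiset.replicate 2 i) :
    (PowerSeries.mk fun m =>
        ((m : ℚ) ^ n / ((n + 1 : ℕ) : ℚ)) * ((n + m).choose m : ℚ)) *
      (1 - PowerSeries.X) ^ (2 * n + 1) = (qsPoly M : PowerSeries ℚ) := by

  have hM' : M = doubled (Finset.Icc 1 n) := hM
  have hcard : (Finset.Icc 1 n).card = n := by simp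
  rw [hM', qsPoly_doubled (Finset.nonempty_Icc.2 hn), coe_descentPoly, hcard, descentSeries_eq]
end
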